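/- For every r > 0, the expected volume of the intersection of the fixed oloid Ω_r with a uniformly placed hitting ball of radius r satisfies ( ∫_{ℝ³} vol(Ω_r ∩ B̄(x,r)) dλ(x) ) / λ{ x : Ω_r ∩ B̄(x,r) ≠ ∅ } = 16π·[2E(√3/2) + K(√3/2)]·r³ / ( 3·[ 9π² + 32π + 8E(√3/2) + 22K(√3/2) − 24I ] ). -/

import Mathlib

open MeasureTheory Real Pointwise

noncomputable section

/-- The circle `k_A = {(x,y,z) : x² + (y+1/2)² = 1 ∧ z = 0}`. -/
def kA : Set (EuclideanSpace ℝ (Fin 3)) :=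
  {p | p 0 ^ 2 + (p 1 + 1/2) ^ 2 = 1 ∧ p 2 = 0}

/-- The circle `k_B = {(x,y,z) : (y−1/2)² + z² = 1 ∧ x = 0}`. -/
def kB : Set (EuclideanSpace ℝ (Fin 3)) :=
  {p | (p 1 - 1/2) ^ 2 + p 2 ^ 2 = 1 ∧ p 0 = 0}

/-- The oloid `Ω₁`: the convex hull of `k_A ∪ k_B`. -/
def oloid : Set (EuclideanSpace ℝ (Fin 3)) := convexHull ℝ (kA ∪ kB)

/-- The scaled oloid `Ω_r = r • Ω₁`. -/
def oloidR (r : ℝ) : Set (EuclideanSpace ℝ (Fin 3)) := r • oloid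

/-- Complete elliptic integral of the first kind `K(k)`. -/
def ellipticK (k : ℝ) : ℝ := ∫ x in (0:ℝ)..(π/2), 1 / Real.sqrt (1 - k^2 * Real.sin x ^ 2)

/-- Complete elliptic integral of the second kind `E(k)`. -/
def ellipticE (k : ℝ) : ℝ := ∫ x in (0:ℝ)..(π/2), Real.sqrt (1 - k^2 * Real.sin x ^ 2)

/-- The constant `I = ∫₀^{π/2} arccos(cos x/(1+cos x)) dx`. -/
def constI : ℝ := ∫ x in (0:ℝ)..(π/2), Real.arccos (Real.cos x / (1 + Real.cos x))

/-- Support function `h_C(u) = sup {⟨x,u⟩ : x ∈ C}` of a set `C ⊆ ℝ³`. -/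
def suppFn (C : Set (EuclideanSpace ℝ (Fin 3))) (u : EuclideanSpace ℝ (Fin 3)) : ℝ :=
  sSup ((fun x => (inner ℝ x u : ℝ)) '' C)

/-- Mean width of `C`: `(1/(4π)) ∫_{S²} (h_C(u) + h_C(−u)) dσ(u)`, where `σ` is the
2-dimensional Hausdorff measure on the unit sphere. (For `C = ∅` this gives `0`.) -/
def meanWidth (C : Set (EuclideanSpace ℝ (Fin 3))) : ℝ :=
  (1 / (4 * π)) *
    ∫ u in Metric.sphere (0 : EuclideanSpace ℝ (Fin 3)) 1, (suppFn C u + suppFn C (-u)) ∂μH[2]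

/-- The rotation group `SO(3)` as 3×3 real orthogonal matrices of determinant 1. -/
abbrev SO3 := Matrix.specialOrthogonalGroup (Fin 3) ℝ

instance : MeasurableSpace SO3 := borel SO3

instance : BorelSpace SO3 := ⟨rfl⟩

/-- The action of a rotation `θ ∈ SO(3)` on a point of `ℝ³`. -/
def rotate (θ : SO3) (p : EuclideanSpace ℝ (Fin 3)) : EuclideanSpace ℝ (Fin 3) :=
  (EuclideanSpace.equiv (Fin 3) ℝ).symm (Matrix.mulVec θ.1 (EuclideanSpace.equiv (Fin 3) ℝ p))

/-- `θ·S + x`: the image of `S` under the rotation `θ` followed by translation by `x`. -/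
def moveSet (θ : SO3) (x : EuclideanSpace ℝ (Fin 3)) (S : Set (EuclideanSpace ℝ (Fin 3))) :
    Set (EuclideanSpace ℝ (Fin 3)) :=
  (fun p => rotate θ p + x) '' S

namespace Oloid

local notation "E3" => EuclideanSpace ℝ (Fin 3)

/-- Cartesian coordinates as nested pairs. -/
def coords (x : E3) : ℝ × ℝ × ℝ := (x 0, x 1, x 2)

theorem measurePreserving_coords : MeasurePreserving coords := by
  have h1 := PiLp.volume_preserving_ofLp (Fin 3)
  have h2 := volume_preserving_piFinSuccAbove (fun _ : Fin 3 => ℝ) 0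
  have h3 := (MeasurePreserving.id (volume : Measure ℝ)).prod (volume_preserving_finTwoArrow ℝ)
  exact (h3.comp h2).comp h1

theorem coords_surjective : Function.Surjective coords := fun q =>
  ⟨!₂[q.1, q.2.1, q.2.2], by simp [coords]⟩

theorem coords_injective : Function.Injective coords := fun x y h => by
  simp only [coords, Prod.mk.injEq] at h
  ext i
  fin_cases i
  · exact h.1
  · exact h.2.1
  · exact h.2.2

/-- The linear form `(p, q, r) ↦ v 0 * p + v 1 * q + v 2 * r`. -/
def form (v : Fin 3 → ℝ) : ℝ × ℝ × ℝ →L[ℝ] ℝ :=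
  v 0 • ContinuousLinearMap.fst ℝ ℝ (ℝ × ℝ)
    + v 1 • (ContinuousLinearMap.fst ℝ ℝ ℝ).comp (ContinuousLinearMap.snd ℝ ℝ (ℝ × ℝ))
    + v 2 • (ContinuousLinearMap.snd ℝ ℝ ℝ).comp (ContinuousLinearMap.snd ℝ ℝ (ℝ × ℝ))

@[simp] theorem form_apply (v : Fin 3 → ℝ) (p : ℝ × ℝ × ℝ) :
    form v p = v 0 * p.1 + v 1 * p.2.1 + v 2 * p.2.2 := by
  simp [form]

/-- `coords` as a continuous linear map. -/
def coordsL : E3 →L[ℝ] ℝ × ℝ × ℝ :=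
  (EuclideanSpace.proj (0 : Fin 3)).prod
    ((EuclideanSpace.proj (1 : Fin 3)).prod (EuclideanSpace.proj (2 : Fin 3)))

theorem volume_image_eq_lintegral {F : ℝ × ℝ × ℝ → E3}
    {M : ℝ × ℝ × ℝ → Matrix (Fin 3) (Fin 3) ℝ} {D : Set (ℝ × ℝ × ℝ)} (hD : MeasurableSet D)
    (hF : ∀ q i, HasFDerivAt (fun p => F p i) (form (M q i)) q) (hinj : Set.InjOn F D) :
    MeasurableSet (F '' D) ∧ volume (F '' D) = ∫⁻ q in D, ENNReal.ofReal |(M q).det| := by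
  have hmp := measurePreserving_coords
  have hD' : MeasurableSet (coords ⁻¹' D) := hmp.measurable hD
  let L : E3 → (E3 →L[ℝ] E3) :=
    fun x => LinearMap.toContinuousLinearMap
      (Matrix.toLin (EuclideanSpace.basisFun (Fin 3) ℝ).toBasis
        (EuclideanSpace.basisFun (Fin 3) ℝ).toBasis (M (coords x)))
  have hdet : ∀ x, (L x).det = (M (coords x)).det := fun x => by
    simp only [L, ContinuousLinearMap.det, LinearMap.coe_toContinuousLinearMap, LinearMap.det_toLin]
  have hder : ∀ x, HasFDerivAt (F ∘ coords) (L x) x := by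
    intro x
    rw [← hasFDerivWithinAt_univ, hasFDerivWithinAt_euclidean]
    intro i
    rw [hasFDerivWithinAt_univ]
    have h1 : HasFDerivAt coords coordsL x := coordsL.hasFDerivAt
    refine ((hF (coords x) i).comp x h1).congr_fderiv ?_
    ext v
    simp [L, coordsL, Matrix.toLin_apply, Matrix.mulVec, dotProduct, Fin.sum_univ_three]
    fin_cases i <;> simp
  have hi : Set.InjOn (F ∘ coords) (coords ⁻¹' D) := fun x hx y hy h =>
    coords_injective (hinj hx hy h)
  have him : (F ∘ coords) '' (coords ⁻¹' D) = F '' D := by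
    rw [Set.image_comp, Set.image_preimage_eq _ coords_surjective]
  rw [← him]
  refine ⟨measurable_image_of_fderivWithin hD'
    (fun x _ => (hder x).hasFDerivWithinAt) hi, ?_⟩
  rw [← lintegral_abs_det_fderiv_eq_addHaar_image volume hD'
    (fun x _ => (hder x).hasFDerivWithinAt) hi]
  simp_rw [hdet]
  exact hmp.setLIntegral_comp_preimage_emb
    (hmp.measurable.measurableEmbedding coords_injective)
    (fun q => ENNReal.ofReal |(M q).det|) D

theorem setLIntegral_box {Js : Set ℝ} (h1 : Set.Ioo 0 1 ⊆ Js) (h2 : Js ⊆ Set.Icc 0 1)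
    {b : ℝ} (hb : 0 ≤ b) {J : ℝ → ℝ → ℝ → ℝ}
    (hJ : Continuous fun q : ℝ × ℝ × ℝ => J q.1 q.2.1 q.2.2)
    (hpos : ∀ x ∈ Set.Icc 0 b, ∀ s ∈ Set.Icc (0 : ℝ) 1, ∀ ρ ∈ Set.Icc (0 : ℝ) 1, 0 ≤ J x s ρ) :
    ∫⁻ q in Set.Ioo 0 b ×ˢ Js ×ˢ Set.Ioc (0 : ℝ) 1, ENNReal.ofReal (J q.1 q.2.1 q.2.2)
      = ENNReal.ofReal (∫ x in (0 : ℝ)..b, ∫ s in (0 : ℝ)..1, ∫ ρ in (0 : ℝ)..1, J x s ρ) := by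
  have hJs : Js =ᵐ[volume] Set.Ioc (0 : ℝ) 1 := by
    refine Filter.EventuallyLE.antisymm ?_ ?_
    · exact Filter.EventuallyLE.trans (LE.le.eventuallyLE h2) Ioc_ae_eq_Icc.symm.le
    · exact Filter.EventuallyLE.trans Ioo_ae_eq_Ioc.symm.le (LE.le.eventuallyLE h1)
  have hres : (volume : Measure (ℝ × ℝ × ℝ)).restrict (Set.Ioo 0 b ×ˢ Js ×ˢ Set.Ioc (0 : ℝ) 1)
      = volume.restrict (Set.Ioc 0 b ×ˢ Set.Ioc (0 : ℝ) 1 ×ˢ Set.Ioc (0 : ℝ) 1) := by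
    simp only [Measure.volume_eq_prod, ← Measure.prod_restrict]
    rw [Measure.restrict_congr_set hJs, Measure.restrict_congr_set Ioo_ae_eq_Ioc]
  have hcomp : IsCompact (Set.Icc 0 b ×ˢ Set.Icc (0 : ℝ) 1 ×ˢ Set.Icc (0 : ℝ) 1) :=
    isCompact_Icc.prod (isCompact_Icc.prod isCompact_Icc)
  have hsub : Set.Ioc 0 b ×ˢ Set.Ioc (0 : ℝ) 1 ×ˢ Set.Ioc (0 : ℝ) 1
      ⊆ Set.Icc 0 b ×ˢ Set.Icc (0 : ℝ) 1 ×ˢ Set.Icc (0 : ℝ) 1 :=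
    Set.prod_mono Set.Ioc_subset_Icc_self
      (Set.prod_mono Set.Ioc_subset_Icc_self Set.Ioc_subset_Icc_self)
  have hint : IntegrableOn (fun q : ℝ × ℝ × ℝ => J q.1 q.2.1 q.2.2)
      (Set.Ioc 0 b ×ˢ Set.Ioc (0 : ℝ) 1 ×ˢ Set.Ioc (0 : ℝ) 1) :=
    (hJ.continuousOn.integrableOn_compact hcomp).mono_set hsub
  have hmeas : MeasurableSet (Set.Ioc 0 b ×ˢ Set.Ioc (0 : ℝ) 1 ×ˢ Set.Ioc (0 : ℝ) 1) :=
    measurableSet_Ioc.prod (measurableSet_Ioc.prod measurableSet_Ioc)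
  rw [hres, ← ofReal_integral_eq_lintegral_ofReal hint]
  · congr 1
    rw [Measure.volume_eq_prod, setIntegral_prod _ hint, intervalIntegral.integral_of_le hb]
    refine setIntegral_congr_fun measurableSet_Ioc fun x _ => ?_
    simp only
    rw [intervalIntegral.integral_of_le zero_le_one, Measure.volume_eq_prod, setIntegral_prod]
    · refine setIntegral_congr_fun measurableSet_Ioc fun s _ => ?_
      simp only
      rw [intervalIntegral.integral_of_le zero_le_one]
    · have hc : Continuous fun q : ℝ × ℝ => J x q.1 q.2 :=
        hJ.comp (Continuous.prodMk_right x)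
      have hK : IsCompact (Set.Icc (0 : ℝ) 1 ×ˢ Set.Icc (0 : ℝ) 1) :=
        isCompact_Icc.prod isCompact_Icc
      exact (hc.continuousOn.integrableOn_compact hK).mono_set
        (Set.prod_mono Set.Ioc_subset_Icc_self Set.Ioc_subset_Icc_self)
  · refine (ae_restrict_iff' hmeas).2 (Filter.Eventually.of_forall fun q hq => ?_)
    have := hsub hq
    exact hpos _ this.1 _ this.2.1 _ this.2.2

theorem volume_image_box {F : ℝ × ℝ × ℝ → E3}
    {M : ℝ × ℝ × ℝ → Matrix (Fin 3) (Fin 3) ℝ}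
    (hF : ∀ q i, HasFDerivAt (fun p => F p i) (form (M q i)) q)
    {Js : Set ℝ} (hJs : MeasurableSet Js) (h1 : Set.Ioo 0 1 ⊆ Js) (h2 : Js ⊆ Set.Icc 0 1)
    {b : ℝ} (hb : 0 ≤ b)
    (hinj : Set.InjOn F (Set.Ioo 0 b ×ˢ Js ×ˢ Set.Ioc (0 : ℝ) 1))
    {J : ℝ → ℝ → ℝ → ℝ} (hJ : Continuous fun q : ℝ × ℝ × ℝ => J q.1 q.2.1 q.2.2)
    (hpos : ∀ x ∈ Set.Icc 0 b, ∀ s ∈ Set.Icc (0 : ℝ) 1, ∀ ρ ∈ Set.Icc (0 : ℝ) 1, 0 ≤ J x s ρ)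
    (hdet : ∀ q, |(M q).det| = |J q.1 q.2.1 q.2.2|) :
    MeasurableSet (F '' (Set.Ioo 0 b ×ˢ Js ×ˢ Set.Ioc (0 : ℝ) 1)) ∧
    volume (F '' (Set.Ioo 0 b ×ˢ Js ×ˢ Set.Ioc (0 : ℝ) 1))
      = ENNReal.ofReal (∫ x in (0 : ℝ)..b, ∫ s in (0 : ℝ)..1, ∫ ρ in (0 : ℝ)..1, J x s ρ) := by
  have hm : MeasurableSet (Set.Ioo 0 b ×ˢ Js ×ˢ Set.Ioc (0 : ℝ) 1) :=
    measurableSet_Ioo.prod (hJs.prod measurableSet_Ioc)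
  obtain ⟨ha, hv⟩ := volume_image_eq_lintegral hm hF hinj
  refine ⟨ha, ?_⟩
  rw [hv, ← setLIntegral_box h1 h2 hb hJ hpos]
  refine setLIntegral_congr_fun hm fun q hq => ?_
  rw [hdet, abs_of_nonneg]
  exact hpos _ (Set.Ioo_subset_Icc_self hq.1) _ (h2 hq.2.1) _ (Set.Ioc_subset_Icc_self hq.2.2)

/-! ### The functions parametrising the oloid -/

/-- Sine of half the angle on the first circle. -/
def sS (x : ℝ) : ℝ := √3 / 2 * sin x

/-- Cosine of half the angle on the first circle. -/
def cC (x : ℝ) : ℝ := √(1 - 3 / 4 * sin x ^ 2)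

/-- Cosine of half the angle on the second circle. -/
def dD (x : ℝ) : ℝ := 1 / (2 * cC x)

/-- Sine of half the angle on the second circle. -/
def tT (x : ℝ) : ℝ := √3 / 2 * cos x / cC x

/-- Half the angle on the first circle. -/
def uU (x : ℝ) : ℝ := arcsin (sS x)

/-- Half the angle on the second circle. -/
def vV (x : ℝ) : ℝ := arcsin (tT x)

theorem radicand_pos (x : ℝ) : 0 < 1 - 3 / 4 * sin x ^ 2 := by
  nlinarith [sin_sq_le_one x]

theorem cC_pos (x : ℝ) : 0 < cC x := sqrt_pos.2 (radicand_pos x)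

theorem cC_sq (x : ℝ) : cC x ^ 2 = 1 - 3 / 4 * sin x ^ 2 := sq_sqrt (radicand_pos x).le

theorem dD_pos (x : ℝ) : 0 < dD x := by
  have := cC_pos x
  unfold dD
  positivity

theorem cC_mul_dD (x : ℝ) : 2 * (cC x * dD x) = 1 := by
  have := (cC_pos x).ne'
  unfold dD
  field_simp

theorem sS_sq (x : ℝ) : sS x ^ 2 = 1 - cC x ^ 2 := by
  rw [cC_sq, sS, mul_pow, div_pow, sq_sqrt (by norm_num)]
  ring

theorem tT_sq (x : ℝ) : tT x ^ 2 = 1 - dD x ^ 2 := by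
  have h := (cC_pos x).ne'
  have h2 := cC_sq x
  rw [tT, dD, div_pow, mul_pow, div_pow, sq_sqrt (by norm_num), cos_sq']
  field_simp
  linarith

theorem sS_pos {x : ℝ} (hx : x ∈ Set.Ioo 0 (π / 2)) : 0 < sS x := by
  have := sin_pos_of_pos_of_lt_pi hx.1 (by linarith [hx.2, pi_pos])
  unfold sS
  positivity

theorem tT_pos {x : ℝ} (hx : x ∈ Set.Ioo 0 (π / 2)) : 0 < tT x := by
  have := cos_pos_of_mem_Ioo ⟨by linarith [hx.1, pi_pos], hx.2⟩
  have := cC_pos x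
  unfold tT
  positivity

theorem sS_nonneg {x : ℝ} (hx : x ∈ Set.Icc 0 (π / 2)) : 0 ≤ sS x := by
  have := sin_nonneg_of_nonneg_of_le_pi hx.1 (by linarith [hx.2, pi_pos])
  unfold sS
  positivity

theorem tT_nonneg {x : ℝ} (hx : x ∈ Set.Icc 0 (π / 2)) : 0 ≤ tT x := by
  have := cos_nonneg_of_mem_Icc ⟨by linarith [hx.1, pi_pos], hx.2⟩
  have := cC_pos x
  unfold tT
  positivity

theorem abs_sS_lt_one (x : ℝ) : |sS x| < 1 := by
  rw [← sq_lt_one_iff_abs_lt_one]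
  nlinarith [sS_sq x, cC_pos x]

theorem abs_tT_lt_one (x : ℝ) : |tT x| < 1 := by
  rw [← sq_lt_one_iff_abs_lt_one]
  nlinarith [tT_sq x, dD_pos x]

theorem sS_injOn : Set.InjOn sS (Set.Ioo 0 (π / 2)) := fun x hx y hy h => by
  have h3 : (0 : ℝ) < √3 := by positivity
  have : sin x = sin y := mul_left_cancel₀ (by positivity) h
  exact injOn_sin ⟨by linarith [hx.1, pi_pos], hx.2.le⟩ ⟨by linarith [hy.1, pi_pos], hy.2.le⟩ this

theorem sin_vV (x : ℝ) : sin (vV x) = tT x :=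
  sin_arcsin (abs_lt.1 (abs_tT_lt_one x)).1.le (abs_lt.1 (abs_tT_lt_one x)).2.le

theorem cos_vV (x : ℝ) : cos (vV x) = dD x := by
  rw [vV, cos_arcsin, tT_sq, sub_sub_cancel, sqrt_sq (dD_pos x).le]

theorem cos_uU (x : ℝ) : cos (uU x) = cC x := by
  rw [uU, cos_arcsin, sS_sq, sub_sub_cancel, sqrt_sq (cC_pos x).le]

theorem vV_nonneg {x : ℝ} (hx : x ∈ Set.Icc 0 (π / 2)) : 0 ≤ vV x := arcsin_nonneg.2 (tT_nonneg hx)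

theorem vV_pos {x : ℝ} (hx : x ∈ Set.Ioo 0 (π / 2)) : 0 < vV x := arcsin_pos.2 (tT_pos hx)

theorem vV_lt (x : ℝ) : vV x < π / 2 := arcsin_lt_pi_div_two.2 (abs_lt.1 (abs_tT_lt_one x)).2

theorem hasDerivAt_sS (x : ℝ) : HasDerivAt sS (tT x * cC x) x := by
  refine ((hasDerivAt_sin x).const_mul (√3 / 2)).congr_deriv ?_
  have := (cC_pos x).ne'
  unfold tT
  field_simp

theorem hasDerivAt_cC (x : ℝ) : HasDerivAt cC (-(sS x * tT x)) x := by
  have h := ((((hasDerivAt_sin x).pow 2).const_mul (3 / 4 : ℝ)).const_sub 1).sqrt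
    (radicand_pos x).ne'
  refine h.congr_deriv ?_
  change _ / (2 * cC x) = _
  have := (cC_pos x).ne'
  have h3 : √3 ^ 2 = (3 : ℝ) := sq_sqrt (by norm_num)
  unfold tT sS
  field_simp
  simp [h3]
  ring

theorem hasDerivAt_dD (x : ℝ) : HasDerivAt dD (2 * sS x * tT x * dD x ^ 2) x := by
  have h := (hasDerivAt_const x (1 : ℝ)).div ((hasDerivAt_cC x).const_mul 2)
    (mul_pos two_pos (cC_pos x)).ne'
  refine h.congr_deriv ?_
  have := (cC_pos x).ne'
  unfold dD
  field_simp
  ring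

theorem hasDerivAt_tT (x : ℝ) : HasDerivAt tT (-(2 * sS x * dD x ^ 3)) x := by
  have h := ((hasDerivAt_cos x).const_mul (√3 / 2)).div (hasDerivAt_cC x) (cC_pos x).ne'
  refine h.congr_deriv ?_
  have h1 := (cC_pos x).ne'
  have h2 := cC_sq x
  have h3 : √3 ^ 2 = (3 : ℝ) := sq_sqrt (by norm_num)
  have h4 := sin_sq_add_cos_sq x
  unfold tT sS dD
  field_simp
  rw [h3]
  have : cos x ^ 2 = 1 - sin x ^ 2 := by linarith
  rw [this, h2]
  ring

theorem continuous_sS : Continuous sS :=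
  continuous_iff_continuousAt.2 fun x => (hasDerivAt_sS x).continuousAt

theorem continuous_cC : Continuous cC :=
  continuous_iff_continuousAt.2 fun x => (hasDerivAt_cC x).continuousAt

theorem continuous_dD : Continuous dD :=
  continuous_iff_continuousAt.2 fun x => (hasDerivAt_dD x).continuousAt

theorem continuous_tT : Continuous tT :=
  continuous_iff_continuousAt.2 fun x => (hasDerivAt_tT x).continuousAt

theorem continuous_vV : Continuous vV := continuous_arcsin.comp continuous_tT

theorem hasDerivAt_uU (x : ℝ) : HasDerivAt uU (tT x) x := by
  have h := abs_lt.1 (abs_sS_lt_one x)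
  refine ((hasDerivAt_arcsin h.1.ne' h.2.ne).comp x (hasDerivAt_sS x)).congr_deriv ?_
  have := (cC_pos x).ne'
  rw [sS_sq, sub_sub_cancel, sqrt_sq (cC_pos x).le]
  field_simp

theorem hasDerivAt_vV (x : ℝ) : HasDerivAt vV (-(2 * sS x * dD x ^ 2)) x := by
  have h := abs_lt.1 (abs_tT_lt_one x)
  refine ((hasDerivAt_arcsin h.1.ne' h.2.ne).comp x (hasDerivAt_tT x)).congr_deriv ?_
  have := (dD_pos x).ne'
  rw [tT_sq, sub_sub_cancel, sqrt_sq (dD_pos x).le]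
  field_simp

/-! ### Derivatives of functions of three variables -/

theorem hasFDerivAt_fst {f : ℝ → ℝ} {f' : ℝ} {q : ℝ × ℝ × ℝ} (h : HasDerivAt f f' q.1) :
    HasFDerivAt (fun p : ℝ × ℝ × ℝ => f p.1) (form ![f', 0, 0]) q := by
  refine (h.comp_hasFDerivAt q _root_.hasFDerivAt_fst).congr_fderiv ?_
  ext <;> simp

theorem hasFDerivAt_snd_fst (q : ℝ × ℝ × ℝ) :
    HasFDerivAt (fun p : ℝ × ℝ × ℝ => p.2.1) (form ![0, 1, 0]) q := by
  refine ((ContinuousLinearMap.fst ℝ ℝ ℝ).comp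
    (ContinuousLinearMap.snd ℝ ℝ (ℝ × ℝ))).hasFDerivAt.congr_fderiv ?_
  ext <;> simp

theorem hasFDerivAt_snd_snd (q : ℝ × ℝ × ℝ) :
    HasFDerivAt (fun p : ℝ × ℝ × ℝ => p.2.2) (form ![0, 0, 1]) q := by
  refine ((ContinuousLinearMap.snd ℝ ℝ ℝ).comp
    (ContinuousLinearMap.snd ℝ ℝ (ℝ × ℝ))).hasFDerivAt.congr_fderiv ?_
  ext <;> simp

section

variable {f g : ℝ × ℝ × ℝ → ℝ} {v w : Fin 3 → ℝ} {q : ℝ × ℝ × ℝ}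

theorem hasFDerivAt_add (hf : HasFDerivAt f (form v) q) (hg : HasFDerivAt g (form w) q) :
    HasFDerivAt (fun p => f p + g p) (form (v + w)) q := by
  refine (hf.add hg).congr_fderiv ?_
  ext <;> simp

theorem hasFDerivAt_mul (hf : HasFDerivAt f (form v) q) (hg : HasFDerivAt g (form w) q) :
    HasFDerivAt (fun p => f p * g p) (form (f q • w + g q • v)) q := by
  refine (hf.mul hg).congr_fderiv ?_
  ext <;> simp

theorem hasFDerivAt_comp {h : ℝ → ℝ} {h' : ℝ} (hh : HasDerivAt h h' (f q))
    (hf : HasFDerivAt f (form v) q) : HasFDerivAt (fun p => h (f p)) (form (h' • v)) q := by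
  refine (hh.comp_hasFDerivAt q hf).congr_fderiv ?_
  ext <;> simp

theorem hasFDerivAt_of_eq (hf : HasFDerivAt f (form v) q) (h0 : v 0 = w 0) (h1 : v 1 = w 1)
    (h2 : v 2 = w 2) : HasFDerivAt f (form w) q := by
  have : v = w := by
    ext i
    fin_cases i <;> assumption
  exact this ▸ hf

end

/-! ### The pieces of the oloid and of its parallel body -/

/-- The cone from the origin over the ruled surface. -/
def coneMap (q : ℝ × ℝ × ℝ) : E3 :=
  !₂[q.2.2 * ((1 + -1 * q.2.1) * (2 * sS q.1 * cC q.1)),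
    q.2.2 * ((1 + -1 * q.2.1) * (1 / 2 + -2 * cC q.1 ^ 2) + q.2.1 * (2 * dD q.1 ^ 2 + -1 / 2)),
    q.2.2 * (q.2.1 * (2 * tT q.1 * dD q.1))]

/-- The points at distance `q.2.2` above the ruled surface. -/
def slabMap (q : ℝ × ℝ × ℝ) : E3 :=
  !₂[(1 + -1 * q.2.1) * (2 * sS q.1 * cC q.1) + q.2.2 * sS q.1,
    (1 + -1 * q.2.1) * (1 / 2 + -2 * cC q.1 ^ 2) + q.2.1 * (2 * dD q.1 ^ 2 + -1 / 2)
      + q.2.2 * (dD q.1 + -1 * cC q.1),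
    q.2.1 * (2 * tT q.1 * dD q.1) + q.2.2 * tT q.1]

/-- The points at distance `q.2.2` from the first circle. -/
def tubeMap (q : ℝ × ℝ × ℝ) : E3 :=
  !₂[2 * sS q.1 * cC q.1 * (1 + q.2.2 * cos (q.2.1 * vV q.1)),
    -1 / 2 + (1 + -2 * cC q.1 ^ 2) * (1 + q.2.2 * cos (q.2.1 * vV q.1)),
    q.2.2 * sin (q.2.1 * vV q.1)]

theorem hasDerivAt_sin_two (x : ℝ) :
    HasDerivAt (fun x => 2 * sS x * cC x) (2 * tT x * (cC x ^ 2 - sS x ^ 2)) x := by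
  refine (((hasDerivAt_sS x).const_mul 2).mul (hasDerivAt_cC x)).congr_deriv ?_
  ring

theorem hasDerivAt_cos_two (k x : ℝ) :
    HasDerivAt (fun x => k + -2 * cC x ^ 2) (4 * cC x * sS x * tT x) x := by
  refine ((((hasDerivAt_cC x).pow 2).const_mul (-2)).const_add k).congr_deriv ?_
  simp
  ring

theorem hasDerivAt_cos_two' (x : ℝ) :
    HasDerivAt (fun x => 2 * dD x ^ 2 + -1 / 2) (8 * sS x * tT x * dD x ^ 3) x := by
  refine ((((hasDerivAt_dD x).pow 2).const_mul 2).add_const (-1 / 2)).congr_deriv ?_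
  simp
  ring

theorem hasDerivAt_sin_two' (x : ℝ) :
    HasDerivAt (fun x => 2 * tT x * dD x) (4 * sS x * dD x ^ 2 * (tT x ^ 2 - dD x ^ 2)) x := by
  refine (((hasDerivAt_tT x).const_mul 2).mul (hasDerivAt_dD x)).congr_deriv ?_
  ring

theorem hasFDerivAt_one_sub (q : ℝ × ℝ × ℝ) :
    HasFDerivAt (fun p : ℝ × ℝ × ℝ => 1 + -1 * p.2.1) (form ![0, -1, 0]) q := by
  have h : HasDerivAt (fun t : ℝ => 1 + -1 * t) (-1 * 1) q.2.1 :=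
    ((hasDerivAt_id _).const_mul (-1)).const_add 1
  refine hasFDerivAt_of_eq (hasFDerivAt_comp (h := fun t => 1 + -1 * t) h (hasFDerivAt_snd_fst q))
    ?_ ?_ ?_ <;> simp

/-- Jacobian matrix of `coneMap`. -/
def coneJac (q : ℝ × ℝ × ℝ) : Matrix (Fin 3) (Fin 3) ℝ :=
  !![q.2.2 * (1 - q.2.1) * (2 * tT q.1 * (cC q.1 ^ 2 - sS q.1 ^ 2)),
      -q.2.2 * (2 * sS q.1 * cC q.1), (1 - q.2.1) * (2 * sS q.1 * cC q.1);
    q.2.2 * ((1 - q.2.1) * (4 * cC q.1 * sS q.1 * tT q.1)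
        + q.2.1 * (8 * sS q.1 * tT q.1 * dD q.1 ^ 3)),
      q.2.2 * (2 * cC q.1 ^ 2 + 2 * dD q.1 ^ 2 - 1),
      (1 - q.2.1) * (1 / 2 - 2 * cC q.1 ^ 2) + q.2.1 * (2 * dD q.1 ^ 2 - 1 / 2);
    q.2.2 * q.2.1 * (4 * sS q.1 * dD q.1 ^ 2 * (tT q.1 ^ 2 - dD q.1 ^ 2)),
      q.2.2 * (2 * tT q.1 * dD q.1), q.2.1 * (2 * tT q.1 * dD q.1)]

theorem hasFDerivAt_coneMap (q : ℝ × ℝ × ℝ) (i : Fin 3) :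
    HasFDerivAt (fun p => coneMap p i) (form (coneJac q i)) q := by
  have hs := hasFDerivAt_snd_fst q
  have hr := hasFDerivAt_snd_snd q
  have h1 := hasFDerivAt_one_sub q
  have ha := hasFDerivAt_mul h1 (hasFDerivAt_fst (hasDerivAt_sin_two q.1))
  have hb := hasFDerivAt_add (hasFDerivAt_mul h1 (hasFDerivAt_fst (hasDerivAt_cos_two (1 / 2) q.1)))
    (hasFDerivAt_mul hs (hasFDerivAt_fst (hasDerivAt_cos_two' q.1)))
  have hc := hasFDerivAt_mul hs (hasFDerivAt_fst (hasDerivAt_sin_two' q.1))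
  fin_cases i
  · refine hasFDerivAt_of_eq (hasFDerivAt_mul hr ha) ?_ ?_ ?_ <;>
      simp [coneJac, -mul_eq_mul_left_iff, -mul_eq_mul_right_iff] <;> ring
  · refine hasFDerivAt_of_eq (hasFDerivAt_mul hr hb) ?_ ?_ ?_ <;>
      simp [coneJac, -mul_eq_mul_left_iff, -mul_eq_mul_right_iff] <;> ring
  · refine hasFDerivAt_of_eq (hasFDerivAt_mul hr hc) ?_ ?_ ?_ <;>
      simp [coneJac, -mul_eq_mul_left_iff, -mul_eq_mul_right_iff]
    ring

/-- Jacobian matrix of `slabMap`. -/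
def slabJac (q : ℝ × ℝ × ℝ) : Matrix (Fin 3) (Fin 3) ℝ :=
  !![(1 - q.2.1) * (2 * tT q.1 * (cC q.1 ^ 2 - sS q.1 ^ 2)) + q.2.2 * (tT q.1 * cC q.1),
      -(2 * sS q.1 * cC q.1), sS q.1;
    (1 - q.2.1) * (4 * cC q.1 * sS q.1 * tT q.1) + q.2.1 * (8 * sS q.1 * tT q.1 * dD q.1 ^ 3)
        + q.2.2 * (2 * sS q.1 * tT q.1 * dD q.1 ^ 2 + sS q.1 * tT q.1),
      2 * cC q.1 ^ 2 + 2 * dD q.1 ^ 2 - 1, dD q.1 - cC q.1;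
    q.2.1 * (4 * sS q.1 * dD q.1 ^ 2 * (tT q.1 ^ 2 - dD q.1 ^ 2))
        - q.2.2 * (2 * sS q.1 * dD q.1 ^ 3),
      2 * tT q.1 * dD q.1, tT q.1]

theorem hasFDerivAt_slabMap (q : ℝ × ℝ × ℝ) (i : Fin 3) :
    HasFDerivAt (fun p => slabMap p i) (form (slabJac q i)) q := by
  have hs := hasFDerivAt_snd_fst q
  have hr := hasFDerivAt_snd_snd q
  have h1 := hasFDerivAt_one_sub q
  have ha := hasFDerivAt_mul h1 (hasFDerivAt_fst (hasDerivAt_sin_two q.1))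
  have hb := hasFDerivAt_add (hasFDerivAt_mul h1 (hasFDerivAt_fst (hasDerivAt_cos_two (1 / 2) q.1)))
    (hasFDerivAt_mul hs (hasFDerivAt_fst (hasDerivAt_cos_two' q.1)))
  have hc := hasFDerivAt_mul hs (hasFDerivAt_fst (hasDerivAt_sin_two' q.1))
  have hd : HasDerivAt (fun x => dD x + -1 * cC x) _ q.1 :=
    (hasDerivAt_dD q.1).add ((hasDerivAt_cC q.1).const_mul (-1))
  fin_cases i
  · refine hasFDerivAt_of_eq (hasFDerivAt_add ha (hasFDerivAt_mul hr
      (hasFDerivAt_fst (hasDerivAt_sS q.1)))) ?_ ?_ ?_ <;>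
      simp [slabJac, -mul_eq_mul_left_iff, -mul_eq_mul_right_iff]
    ring
  · refine hasFDerivAt_of_eq (hasFDerivAt_add hb (hasFDerivAt_mul hr
      (hasFDerivAt_fst hd))) ?_ ?_ ?_ <;>
      simp [slabJac, -mul_eq_mul_left_iff, -mul_eq_mul_right_iff] <;> ring
  · refine hasFDerivAt_of_eq (hasFDerivAt_add hc (hasFDerivAt_mul hr
      (hasFDerivAt_fst (hasDerivAt_tT q.1)))) ?_ ?_ ?_ <;>
      simp [slabJac, -mul_eq_mul_left_iff, -mul_eq_mul_right_iff]
    ring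

/-- Jacobian matrix of `tubeMap`. -/
def tubeJac (q : ℝ × ℝ × ℝ) : Matrix (Fin 3) (Fin 3) ℝ :=
  !![2 * tT q.1 * (cC q.1 ^ 2 - sS q.1 ^ 2) * (1 + q.2.2 * cos (q.2.1 * vV q.1))
        + 2 * sS q.1 * cC q.1
          * (q.2.2 * sin (q.2.1 * vV q.1) * (q.2.1 * (2 * sS q.1 * dD q.1 ^ 2))),
      -(2 * sS q.1 * cC q.1 * (q.2.2 * sin (q.2.1 * vV q.1) * vV q.1)),
      2 * sS q.1 * cC q.1 * cos (q.2.1 * vV q.1);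
    4 * cC q.1 * sS q.1 * tT q.1 * (1 + q.2.2 * cos (q.2.1 * vV q.1))
        + (1 - 2 * cC q.1 ^ 2)
          * (q.2.2 * sin (q.2.1 * vV q.1) * (q.2.1 * (2 * sS q.1 * dD q.1 ^ 2))),
      -((1 - 2 * cC q.1 ^ 2) * (q.2.2 * sin (q.2.1 * vV q.1) * vV q.1)),
      (1 - 2 * cC q.1 ^ 2) * cos (q.2.1 * vV q.1);
    -(q.2.2 * cos (q.2.1 * vV q.1) * (q.2.1 * (2 * sS q.1 * dD q.1 ^ 2))),
      q.2.2 * cos (q.2.1 * vV q.1) * vV q.1, sin (q.2.1 * vV q.1)]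

theorem hasFDerivAt_tubeMap (q : ℝ × ℝ × ℝ) (i : Fin 3) :
    HasFDerivAt (fun p => tubeMap p i) (form (tubeJac q i)) q := by
  have hr := hasFDerivAt_snd_snd q
  have hv := hasFDerivAt_mul (hasFDerivAt_snd_fst q) (hasFDerivAt_fst (hasDerivAt_vV q.1))
  have hcos := hasFDerivAt_comp (hasDerivAt_cos _) hv
  have hsin := hasFDerivAt_comp (hasDerivAt_sin _) hv
  have hw : HasFDerivAt (fun p : ℝ × ℝ × ℝ => 1 + p.2.2 * cos (p.2.1 * vV p.1)) _ q :=
    hasFDerivAt_comp (h := fun t => 1 + t) ((hasDerivAt_id _).const_add 1) (hasFDerivAt_mul hr hcos)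
  fin_cases i
  · refine hasFDerivAt_of_eq (hasFDerivAt_mul (hasFDerivAt_fst (hasDerivAt_sin_two q.1)) hw)
      ?_ ?_ ?_ <;>
      simp [tubeJac, -mul_eq_mul_left_iff, -mul_eq_mul_right_iff] <;> ring
  · refine hasFDerivAt_of_eq (hasFDerivAt_comp (h := fun t => -1 / 2 + t)
      ((hasDerivAt_id _).const_add (-1 / 2))
      (hasFDerivAt_mul (hasFDerivAt_fst (hasDerivAt_cos_two 1 q.1)) hw))
      ?_ ?_ ?_ <;>
      simp [tubeJac, -mul_eq_mul_left_iff, -mul_eq_mul_right_iff] <;> ring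
  · refine hasFDerivAt_of_eq (hasFDerivAt_mul hr hsin) ?_ ?_ ?_ <;>
      simp [tubeJac, -mul_eq_mul_left_iff, -mul_eq_mul_right_iff] <;> ring

theorem det_coneJac (q : ℝ × ℝ × ℝ) : (coneJac q).det =
    q.2.2 ^ 2 * ((cC q.1 + dD q.1) / 2)
      * ((1 - q.2.1) * (4 * tT q.1 ^ 2) + q.2.1 * (8 * sS q.1 ^ 2 * dD q.1 ^ 2)) := by
  have h1 := cC_mul_dD q.1
  have h2 := sS_sq q.1
  have h3 := tT_sq q.1
  rw [Matrix.det_fin_three]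
  simp [coneJac]
  generalize sS q.1 = S at *
  generalize cC q.1 = c at *
  generalize dD q.1 = d at *
  generalize tT q.1 = T at *
  generalize q.2.1 = s at *
  generalize q.2.2 = r at *
  grind

theorem det_slabJac (q : ℝ × ℝ × ℝ) : (slabJac q).det =
    (1 - q.2.1) * (4 * tT q.1 ^ 2) + q.2.1 * (8 * sS q.1 ^ 2 * dD q.1 ^ 2)
      + q.2.2 * (3 * dD q.1) := by
  have h1 := cC_mul_dD q.1
  have h2 := sS_sq q.1
  have h3 := tT_sq q.1
  rw [Matrix.det_fin_three]
  simp [slabJac]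
  generalize sS q.1 = S at *
  generalize cC q.1 = c at *
  generalize dD q.1 = d at *
  generalize tT q.1 = T at *
  generalize q.2.1 = s at *
  generalize q.2.2 = r at *
  grind

theorem det_tubeJac (q : ℝ × ℝ × ℝ) : (tubeJac q).det =
    2 * tT q.1 * vV q.1 * (q.2.2 * (1 + q.2.2 * cos (q.2.1 * vV q.1))) := by
  have h2 := sS_sq q.1
  have h3 := sin_sq_add_cos_sq (q.2.1 * vV q.1)
  rw [Matrix.det_fin_three]
  simp [tubeJac]
  generalize sin (q.2.1 * vV q.1) = a at *
  generalize cos (q.2.1 * vV q.1) = b at *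
  generalize sS q.1 = S at *
  generalize cC q.1 = c at *
  generalize dD q.1 = d at *
  generalize tT q.1 = T at *
  generalize vV q.1 = v at *
  generalize q.2.1 = s at *
  generalize q.2.2 = r at *
  grind

/-! ### The integrals -/

theorem integral_quadratic (a b c : ℝ) :
    ∫ t in (0 : ℝ)..1, (a + b * t + c * t ^ 2) = a + b / 2 + c / 3 := by
  have h : ∀ t ∈ Set.uIcc (0 : ℝ) 1,
      HasDerivAt (fun t => a * t + b / 2 * t ^ 2 + c / 3 * t ^ 3) (a + b * t + c * t ^ 2) t := by
    intro t _
    refine ((((hasDerivAt_id t).const_mul a).add ((hasDerivAt_pow 2 t).const_mul (b / 2))).add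
      ((hasDerivAt_pow 3 t).const_mul (c / 3))).congr_deriv ?_
    simp
    ring
  rw [intervalIntegral.integral_eq_sub_of_hasDerivAt h
    (by apply Continuous.intervalIntegrable; fun_prop)]
  simp

theorem cC_eq (x : ℝ) : √(1 - (√3 / 2) ^ 2 * sin x ^ 2) = cC x := by
  rw [cC, div_pow, sq_sqrt (by norm_num)]
  norm_num

theorem ellipticE_eq : ellipticE (√3 / 2) = ∫ x in (0 : ℝ)..(π / 2), cC x := by
  simp only [ellipticE, cC_eq]

theorem ellipticK_eq : ellipticK (√3 / 2) = ∫ x in (0 : ℝ)..(π / 2), 2 * dD x := by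
  simp only [ellipticK, cC_eq]
  congr 1
  ext x
  have := (cC_pos x).ne'
  unfold dD
  field_simp

theorem integral_dD_cube :
    ∫ x in (0 : ℝ)..(π / 2), dD x ^ 3 = ellipticE (√3 / 2) / 2 := by
  have h : ∀ x ∈ Set.uIcc (0 : ℝ) (π / 2),
      HasDerivAt (fun x => sS x * tT x) (cC x - 2 * dD x ^ 3) x := by
    intro x _
    refine ((hasDerivAt_sS x).mul (hasDerivAt_tT x)).congr_deriv ?_
    have h1 := cC_mul_dD x
    have h2 := sS_sq x
    have h3 := tT_sq x
    generalize sS x = S at *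
    generalize cC x = c at *
    generalize dD x = d at *
    generalize tT x = T at *
    grind
  have hc := continuous_cC
  have hd := continuous_dD
  have := intervalIntegral.integral_eq_sub_of_hasDerivAt h
    (by apply Continuous.intervalIntegrable; fun_prop)
  rw [intervalIntegral.integral_sub (hc.intervalIntegrable _ _)
    (Continuous.intervalIntegrable (by fun_prop) _ _), intervalIntegral.integral_const_mul,
    ← ellipticE_eq] at this
  simp [sS, tT] at this
  linarith

theorem integral_dD_sq : ∫ x in (0 : ℝ)..(π / 2), dD x ^ 2 = π / 4 := by
  have h : ∀ x ∈ Set.uIcc (0 : ℝ) (π / 2),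
      HasDerivAt (fun x => 1 / 2 * (x - arctan (sin x * cos x / (1 + cos x ^ 2))))
        (dD x ^ 2) x := by
    intro x _
    have hp : 1 + cos x ^ 2 ≠ 0 := by positivity
    refine (((hasDerivAt_id x).sub ((((hasDerivAt_sin x).mul (hasDerivAt_cos x)).div
      (((hasDerivAt_cos x).pow 2).const_add 1) hp).arctan)).const_mul (1 / 2)).congr_deriv ?_
    have h1 := (cC_pos x).ne'
    have h2 := cC_sq x
    have h4 := sin_sq_add_cos_sq x
    have h5 : dD x ^ 2 = 1 / (4 * cC x ^ 2) := by
      unfold dD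
      field_simp
      norm_num
    have h6 : cC x ^ 2 ≠ 0 := by positivity
    have h7 : (1 + cos x ^ 2) ^ 2 + (sin x * cos x) ^ 2 = 4 * cC x ^ 2 := by
      rw [h2]
      grind
    have h8 : 1 + (sin x * cos x / (1 + cos x ^ 2)) ^ 2 = 4 * cC x ^ 2 / (1 + cos x ^ 2) ^ 2 := by
      rw [← h7]
      field_simp
    simp only [Pi.mul_apply, Pi.div_apply, Pi.pow_apply]
    rw [h5, h8]
    simp
    field_simp
    rw [h2]
    grind
  have hd := continuous_dD
  rw [intervalIntegral.integral_eq_sub_of_hasDerivAt h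
    (by apply Continuous.intervalIntegrable; fun_prop)]
  simp
  ring

theorem two_mul_tT_sq_add (x : ℝ) : 2 * tT x ^ 2 + 4 * sS x ^ 2 * dD x ^ 2 = 1 + 2 * dD x ^ 2 := by
  have h1 := cC_mul_dD x
  rw [sS_sq, tT_sq]
  generalize cC x = c at *
  generalize dD x = d at *
  grind

theorem integral_cone : (∫ x in (0 : ℝ)..(π / 2), ∫ s in (0 : ℝ)..1, ∫ ρ in (0 : ℝ)..1,
      ρ ^ 2 * ((cC x + dD x) / 2) * ((1 - s) * (4 * tT x ^ 2) + s * (8 * sS x ^ 2 * dD x ^ 2)))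
    = (2 * ellipticE (√3 / 2) + ellipticK (√3 / 2)) / 6 := by
  have hc := continuous_cC
  have hd := continuous_dD
  have h1 (x s : ℝ) : ∫ ρ in (0 : ℝ)..1, ρ ^ 2 * ((cC x + dD x) / 2)
        * ((1 - s) * (4 * tT x ^ 2) + s * (8 * sS x ^ 2 * dD x ^ 2))
      = (cC x + dD x) / 2 * (4 * tT x ^ 2) / 3
        + (cC x + dD x) / 2 * (8 * sS x ^ 2 * dD x ^ 2 - 4 * tT x ^ 2) / 3 * s + 0 * s ^ 2 := by
    have := integral_quadratic 0 0 ((cC x + dD x) / 2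
      * ((1 - s) * (4 * tT x ^ 2) + s * (8 * sS x ^ 2 * dD x ^ 2)))
    refine Eq.trans ?_ (this.trans (by ring))
    congr 1
    ext ρ
    ring
  simp only [h1, integral_quadratic]
  have h2 (x : ℝ) : (cC x + dD x) / 2 * (4 * tT x ^ 2) / 3
      + (cC x + dD x) / 2 * (8 * sS x ^ 2 * dD x ^ 2 - 4 * tT x ^ 2) / 3 / 2 + 0 / 3
      = 1 / 6 * cC x + 1 / 6 * (2 * dD x) + 1 / 3 * dD x ^ 3 := by
    have h3 := two_mul_tT_sq_add x
    have h4 := cC_mul_dD x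
    generalize sS x = S at *
    generalize cC x = c at *
    generalize dD x = d at *
    generalize tT x = T at *
    grind
  simp only [h2]
  rw [intervalIntegral.integral_add (Continuous.intervalIntegrable (by fun_prop) _ _)
    (Continuous.intervalIntegrable (by fun_prop) _ _),
    intervalIntegral.integral_add (Continuous.intervalIntegrable (by fun_prop) _ _)
    (Continuous.intervalIntegrable (by fun_prop) _ _),
    intervalIntegral.integral_const_mul (1 / 6) fun x => 2 * dD x, ← ellipticK_eq]
  simp only [intervalIntegral.integral_const_mul, integral_dD_cube, ← ellipticE_eq]
  ring

theorem integral_slab : (∫ x in (0 : ℝ)..(π / 2), ∫ s in (0 : ℝ)..1, ∫ ρ in (0 : ℝ)..1,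
      ((1 - s) * (4 * tT x ^ 2) + s * (8 * sS x ^ 2 * dD x ^ 2) + ρ * (3 * dD x)))
    = π + 3 / 4 * ellipticK (√3 / 2) := by
  have hd := continuous_dD
  have h1 (x s : ℝ) : ∫ ρ in (0 : ℝ)..1,
        ((1 - s) * (4 * tT x ^ 2) + s * (8 * sS x ^ 2 * dD x ^ 2) + ρ * (3 * dD x))
      = (4 * tT x ^ 2 + 3 * dD x / 2)
        + (8 * sS x ^ 2 * dD x ^ 2 - 4 * tT x ^ 2) * s + 0 * s ^ 2 := by
    have := integral_quadratic ((1 - s) * (4 * tT x ^ 2) + s * (8 * sS x ^ 2 * dD x ^ 2))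
      (3 * dD x) 0
    refine Eq.trans ?_ (this.trans (by ring))
    congr 1
    ext ρ
    ring
  simp only [h1, integral_quadratic]
  have h2 (x : ℝ) : (4 * tT x ^ 2 + 3 * dD x / 2)
      + (8 * sS x ^ 2 * dD x ^ 2 - 4 * tT x ^ 2) / 2 + 0 / 3
      = 1 + 2 * dD x ^ 2 + 3 / 4 * (2 * dD x) := by
    linear_combination two_mul_tT_sq_add x
  simp only [h2]
  rw [intervalIntegral.integral_add (Continuous.intervalIntegrable (by fun_prop) _ _)
    (Continuous.intervalIntegrable (by fun_prop) _ _),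
    intervalIntegral.integral_add (Continuous.intervalIntegrable (by fun_prop) _ _)
    (Continuous.intervalIntegrable (by fun_prop) _ _),
    intervalIntegral.integral_const_mul, intervalIntegral.integral_const_mul,
    integral_dD_sq, ← ellipticK_eq]
  simp
  ring

/-- The relation between the half angles of corresponding points of the two circles. -/
def conjAngle (u : ℝ) : ℝ := arccos (1 / (2 * cos u))

theorem conjAngle_uU {x : ℝ} (hx : x ∈ Set.Icc 0 (π / 2)) : conjAngle (uU x) = vV x := by
  rw [conjAngle, cos_uU]
  change arccos (dD x) = _
  rw [← cos_vV, arccos_cos (vV_nonneg hx) (by linarith [vV_lt x, pi_pos])]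

theorem conjAngle_vV {x : ℝ} (hx : x ∈ Set.Icc 0 (π / 2)) : conjAngle (vV x) = uU x := by
  have h : 1 / (2 * dD x) = cC x := by
    have := (dD_pos x).ne'
    field_simp
    linarith [cC_mul_dD x]
  have h0 : 0 ≤ uU x := arcsin_nonneg.2 (sS_nonneg hx)
  have h1 : uU x ≤ π / 2 := arcsin_le_pi_div_two _
  rw [conjAngle, cos_vV, h, ← cos_uU, arccos_cos h0 (by linarith [pi_pos])]

theorem continuousOn_conjAngle {s : Set ℝ} (hs : ∀ u ∈ s, cos u ≠ 0) :
    ContinuousOn conjAngle s := by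
  refine continuous_arccos.comp_continuousOn ?_
  exact continuousOn_const.div (by fun_prop) fun u hu => mul_ne_zero two_ne_zero (hs u hu)

theorem integral_comp_uU {a b : ℝ} (ha : 0 ≤ a) (hab : a ≤ b) (hb : b ≤ π / 2) :
    ∫ x in a..b, vV x * tT x = ∫ u in uU a..uU b, conjAngle u := by
  rw [← intervalIntegral.integral_comp_mul_deriv'' (f := uU) (f' := tT) (g := conjAngle)
    (continuous_iff_continuousAt.2 fun x => (hasDerivAt_uU x).continuousAt).continuousOn
    (fun x _ => (hasDerivAt_uU x).hasDerivWithinAt) continuous_tT.continuousOn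
    (continuousOn_conjAngle ?_)]
  · refine intervalIntegral.integral_congr fun x hx => ?_
    rw [Set.uIcc_of_le hab] at hx
    simp only [Function.comp]
    rw [conjAngle_uU ⟨ha.trans hx.1, hx.2.trans hb⟩]
  · rintro _ ⟨x, -, rfl⟩
    rw [cos_uU]
    exact (cC_pos x).ne'

theorem integral_comp_vV {a b : ℝ} (ha : 0 ≤ a) (hab : a ≤ b) (hb : b ≤ π / 2) :
    ∫ x in a..b, uU x * (-(2 * sS x * dD x ^ 2)) = ∫ u in vV a..vV b, conjAngle u := by
  have hS := continuous_sS
  have hd := continuous_dD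
  rw [← intervalIntegral.integral_comp_mul_deriv'' (f := vV) (f' := fun x => -(2 * sS x * dD x ^ 2))
    (g := conjAngle) continuous_vV.continuousOn
    (fun x _ => (hasDerivAt_vV x).hasDerivWithinAt) (by fun_prop)
    (continuousOn_conjAngle ?_)]
  · refine intervalIntegral.integral_congr fun x hx => ?_
    rw [Set.uIcc_of_le hab] at hx
    simp only [Function.comp]
    rw [conjAngle_vV ⟨ha.trans hx.1, hx.2.trans hb⟩]
  · rintro _ ⟨x, -, rfl⟩
    rw [cos_vV]
    exact (dD_pos x).ne'

theorem constI_eq : constI = π ^ 2 / 2 - 4 * ∫ u in (0 : ℝ)..(π / 4), conjAngle u := by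
  have h : ∀ y ∈ Set.uIcc 0 (π / 2),
      arccos (cos y / (1 + cos y)) = π - 2 * conjAngle (y / 2) := by
    intro y hy
    rw [Set.uIcc_of_le (by positivity)] at hy
    have hc : √2 / 2 ≤ cos (y / 2) := by
      rw [← cos_pi_div_four]
      exact cos_le_cos_of_nonneg_of_le_pi (by linarith [hy.1]) (by linarith [pi_pos])
        (by linarith [hy.2])
    have h2 : (1 : ℝ) ≤ √2 := by rw [one_le_sqrt]; norm_num
    have h3 : 0 < cos (y / 2) := by linarith
    have h4 : cos y = 2 * cos (y / 2) ^ 2 - 1 := by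
      rw [← cos_two_mul]
      congr 1
      ring
    have h5 : cos (conjAngle (y / 2)) = 1 / (2 * cos (y / 2)) := by
      refine cos_arccos (by linarith [show 0 < 1 / (2 * cos (y / 2)) by positivity]) ?_
      rw [div_le_one (by positivity)]
      linarith
    have h6 : cos y / (1 + cos y) = cos (π - 2 * conjAngle (y / 2)) := by
      rw [cos_pi_sub, cos_two_mul, h5, h4]
      field_simp
      ring
    have h7 : conjAngle (y / 2) ≤ π / 2 := arccos_le_pi_div_two.2 (by positivity)
    have h8 : 0 ≤ conjAngle (y / 2) := arccos_nonneg _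
    rw [h6, arccos_cos (by linarith) (by linarith)]
  have hi : IntervalIntegrable (fun y => 2 * conjAngle (y / 2)) volume 0 (π / 2) := by
    refine ContinuousOn.intervalIntegrable ?_
    refine continuousOn_const.mul ((continuousOn_conjAngle (s := Set.Icc 0 (π / 4)) ?_).comp
      (by fun_prop) ?_)
    · exact fun u hu => (cos_pos_of_mem_Ioo ⟨by linarith [hu.1, pi_pos],
        by linarith [hu.2, pi_pos]⟩).ne'
    · intro y hy
      rw [Set.uIcc_of_le (by positivity)] at hy
      exact ⟨by linarith [hy.1], by linarith [hy.2]⟩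
  rw [constI, intervalIntegral.integral_congr h, intervalIntegral.integral_sub (by simp) hi,
    intervalIntegral.integral_const_mul, intervalIntegral.integral_comp_div _ two_ne_zero]
  simp
  rw [show π / 2 / 2 = π / 4 by ring]
  ring

theorem integral_vV_mul_tT :
    ∫ x in (0 : ℝ)..(π / 2), vV x * tT x = 3 * π ^ 2 / 16 - constI / 2 := by
  have hS := continuous_sS
  have hd := continuous_dD
  have hT := continuous_tT
  have hv := continuous_vV
  have hu : Continuous uU := continuous_iff_continuousAt.2 fun x => (hasDerivAt_uU x).continuousAt
  obtain ⟨x₀, h0, h1, h2⟩ : ∃ x₀, 0 ≤ x₀ ∧ x₀ ≤ π / 2 ∧ uU x₀ = π / 4 := by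
    have h3 : (0 : ℝ) < √3 := by positivity
    have h23 : √2 ^ 2 = (2 : ℝ) := sq_sqrt (by norm_num)
    have h33 : √3 ^ 2 = (3 : ℝ) := sq_sqrt (by norm_num)
    have hle : √2 / √3 ≤ 1 := by
      rw [div_le_one h3]
      exact sqrt_le_sqrt (by norm_num)
    refine ⟨arcsin (√2 / √3), arcsin_nonneg.2 (by positivity), arcsin_le_pi_div_two _, ?_⟩
    rw [uU, sS, sin_arcsin (by linarith [show 0 ≤ √2 / √3 by positivity]) hle]
    rw [show √3 / 2 * (√2 / √3) = √2 / 2 by field_simp, ← sin_pi_div_four,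
      arcsin_sin (by linarith [pi_pos]) (by linarith [pi_pos])]
  have h3 : vV x₀ = π / 4 := by
    rw [← conjAngle_uU ⟨h0, h1⟩, h2, conjAngle, cos_pi_div_four]
    rw [show 1 / (2 * (√2 / 2)) = √2 / 2 by
      have h23 : √2 ^ 2 = (2 : ℝ) := sq_sqrt (by norm_num)
      field_simp
      linarith, ← cos_pi_div_four, arccos_cos (by linarith [pi_pos]) (by linarith [pi_pos])]
  have h4 : uU 0 = 0 := by simp [uU, sS]
  have h5 : vV (π / 2) = 0 := by simp [vV, tT]
  have hp : ∫ x in x₀..(π / 2), vV x * tT x = -(π ^ 2 / 16)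
      + ∫ u in (0 : ℝ)..(π / 4), conjAngle u := by
    rw [intervalIntegral.integral_mul_deriv_eq_deriv_mul (fun x _ => hasDerivAt_vV x)
      (fun x _ => hasDerivAt_uU x) (Continuous.intervalIntegrable (by fun_prop) _ _)
      (hT.intervalIntegrable _ _), h5, h3, h2]
    have := integral_comp_vV h0 h1 le_rfl
    rw [h5, h3, intervalIntegral.integral_symm 0 (π / 4)] at this
    simp only [mul_comm (uU _)] at this
    rw [this]
    ring
  rw [← intervalIntegral.integral_add_adjacent_intervals (b := x₀)
    (Continuous.intervalIntegrable (by fun_prop) _ _)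
    (Continuous.intervalIntegrable (by fun_prop) _ _), hp, integral_comp_uU le_rfl h0 h1, h4, h2,
    constI_eq]
  ring

theorem integral_tube : (∫ x in (0 : ℝ)..(π / 2), ∫ s in (0 : ℝ)..1, ∫ ρ in (0 : ℝ)..1,
      2 * tT x * vV x * (ρ * (1 + ρ * cos (s * vV x))))
    = 3 * π ^ 2 / 16 - constI / 2 + π / 6 := by
  have hd := continuous_dD
  have hT := continuous_tT
  have hv := continuous_vV
  have h1 (x s : ℝ) : ∫ ρ in (0 : ℝ)..1, 2 * tT x * vV x * (ρ * (1 + ρ * cos (s * vV x)))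
      = tT x * vV x + 2 / 3 * tT x * (cos (s * vV x) * vV x) := by
    have := integral_quadratic 0 (2 * tT x * vV x) (2 * tT x * vV x * cos (s * vV x))
    refine Eq.trans ?_ (this.trans (by ring))
    congr 1
    ext ρ
    ring
  have h2 (x : ℝ) : ∫ s in (0 : ℝ)..1, (tT x * vV x + 2 / 3 * tT x * (cos (s * vV x) * vV x))
      = vV x * tT x + 2 / 3 * (1 - dD x ^ 2) := by
    have h : ∀ s ∈ Set.uIcc (0 : ℝ) 1,
        HasDerivAt (fun s => tT x * vV x * s + 2 / 3 * tT x * sin (s * vV x))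
          (tT x * vV x + 2 / 3 * tT x * (cos (s * vV x) * vV x)) s := by
      intro s _
      refine (((hasDerivAt_id s).const_mul (tT x * vV x)).add
        (((hasDerivAt_id s).mul_const (vV x)).sin.const_mul (2 / 3 * tT x))).congr_deriv ?_
      simp
    rw [intervalIntegral.integral_eq_sub_of_hasDerivAt h
      (by apply Continuous.intervalIntegrable; fun_prop)]
    simp [sin_vV]
    linear_combination 2 / 3 * tT_sq x
  simp only [h1, h2]
  rw [intervalIntegral.integral_add (Continuous.intervalIntegrable (by fun_prop) _ _)
    (Continuous.intervalIntegrable (by fun_prop) _ _), integral_vV_mul_tT,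
    intervalIntegral.integral_const_mul, intervalIntegral.integral_sub (by simp)
    (Continuous.intervalIntegrable (by fun_prop) _ _), integral_dD_sq]
  simp
  ring

/-! ### Symmetries -/

/-- The linear isometry that permutes the coordinates along `e` and multiplies them by signs. -/
def axisMap (e : Equiv.Perm (Fin 3)) (ε : Fin 3 → ℝ) (hε : ∀ i, ε i ^ 2 = 1) : E3 →ₗᵢ[ℝ] E3 where
  toFun p := WithLp.toLp 2 fun i => ε i * p (e i)
  map_add' p q := by
    ext i
    simp [mul_add]
  map_smul' a p := by
    ext i
    simp
    ring
  norm_map' p := by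
    rw [EuclideanSpace.norm_eq, EuclideanSpace.norm_eq]
    congr 1
    simp only [LinearMap.coe_mk, AddHom.coe_mk, norm_eq_abs, sq_abs, mul_pow, hε, one_mul]
    exact Equiv.sum_comp e fun i => p i ^ 2

/-- The isometry `(x, y, z) ↦ (z, -y, x)`, which exchanges the two circles. -/
def swap : E3 ≃ₗᵢ[ℝ] E3 :=
  (axisMap (Equiv.swap 0 2) ![1, -1, 1] fun i => by
    fin_cases i <;> norm_num).toLinearIsometryEquiv rfl

/-- The reflection `(x, y, z) ↦ (-x, y, z)`. -/
def negFst : E3 ≃ₗᵢ[ℝ] E3 :=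
  (axisMap 1 ![-1, 1, 1] fun i => by fin_cases i <;> norm_num).toLinearIsometryEquiv rfl

/-- The reflection `(x, y, z) ↦ (x, y, -z)`. -/
def negThd : E3 ≃ₗᵢ[ℝ] E3 :=
  (axisMap 1 ![1, 1, -1] fun i => by fin_cases i <;> norm_num).toLinearIsometryEquiv rfl

@[simp] theorem swap_zero (p : E3) : swap p 0 = p 2 := by simp [swap, axisMap]
@[simp] theorem swap_one (p : E3) : swap p 1 = -p 1 := by
  simp [swap, axisMap, Equiv.swap_apply_of_ne_of_ne]
@[simp] theorem swap_two (p : E3) : swap p 2 = p 0 := by simp [swap, axisMap]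
@[simp] theorem negFst_zero (p : E3) : negFst p 0 = -p 0 := by simp [negFst, axisMap]
@[simp] theorem negFst_one (p : E3) : negFst p 1 = p 1 := by simp [negFst, axisMap]
@[simp] theorem negFst_two (p : E3) : negFst p 2 = p 2 := by simp [negFst, axisMap]
@[simp] theorem negThd_zero (p : E3) : negThd p 0 = p 0 := by simp [negThd, axisMap]
@[simp] theorem negThd_one (p : E3) : negThd p 1 = p 1 := by simp [negThd, axisMap]
@[simp] theorem negThd_two (p : E3) : negThd p 2 = -p 2 := by simp [negThd, axisMap]

theorem ext_three {p q : E3} (h0 : p 0 = q 0) (h1 : p 1 = q 1) (h2 : p 2 = q 2) : p = q := by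
  ext i
  fin_cases i <;> assumption

@[simp] theorem swap_swap (p : E3) : swap (swap p) = p := by apply ext_three <;> simp
@[simp] theorem negFst_negFst (p : E3) : negFst (negFst p) = p := by apply ext_three <;> simp
@[simp] theorem negThd_negThd (p : E3) : negThd (negThd p) = p := by apply ext_three <;> simp

theorem inner_eq (x y : E3) : (inner ℝ x y : ℝ) = x 0 * y 0 + x 1 * y 1 + x 2 * y 2 := by
  simp [PiLp.inner_apply, Fin.sum_univ_three]
  ring

theorem norm_sq_eq (x : E3) : ‖x‖ ^ 2 = x 0 ^ 2 + x 1 ^ 2 + x 2 ^ 2 := by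
  rw [EuclideanSpace.real_norm_sq_eq, Fin.sum_univ_three]

theorem mem_oloid_of_involutive {f : E3 ≃ₗᵢ[ℝ] E3} (hA : ∀ p ∈ kA ∪ kB, f p ∈ kA ∪ kB) {p : E3}
    (hp : p ∈ oloid) : f p ∈ oloid := by
  have : f '' convexHull ℝ (kA ∪ kB) ⊆ convexHull ℝ (kA ∪ kB) := by
    rw [show (f : E3 → E3) = f.toLinearEquiv.toLinearMap from rfl, LinearMap.image_convexHull]
    exact convexHull_mono (by rintro _ ⟨q, hq, rfl⟩; exact hA q hq)
  exact this ⟨p, hp, rfl⟩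

theorem swap_mem_oloid {p : E3} (hp : p ∈ oloid) : swap p ∈ oloid := by
  refine mem_oloid_of_involutive ?_ hp
  rintro q (⟨h1, h2⟩ | ⟨h1, h2⟩)
  · exact Or.inr ⟨by simp; linarith, by simpa using h2⟩
  · exact Or.inl ⟨by simp; linarith, by simpa using h2⟩

theorem negFst_mem_oloid {p : E3} (hp : p ∈ oloid) : negFst p ∈ oloid := by
  refine mem_oloid_of_involutive ?_ hp
  rintro q (⟨h1, h2⟩ | ⟨h1, h2⟩)
  · exact Or.inl ⟨by simp; linarith, by simpa using h2⟩
  · exact Or.inr ⟨by simp; linarith, by simpa using h2⟩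

theorem negThd_mem_oloid {p : E3} (hp : p ∈ oloid) : negThd p ∈ oloid := by
  refine mem_oloid_of_involutive ?_ hp
  rintro q (⟨h1, h2⟩ | ⟨h1, h2⟩)
  · exact Or.inl ⟨by simp; linarith, by simpa using h2⟩
  · exact Or.inr ⟨by simp; linarith, by simpa using h2⟩

/-! ### The oloid as a join of two discs -/

/-- The disc bounded by `kA`. -/
def discA : Set E3 := {p | p 0 ^ 2 + (p 1 + 1 / 2) ^ 2 ≤ 1 ∧ p 2 = 0}

theorem convex_discA : Convex ℝ discA := by
  rintro p ⟨hp, hp2⟩ q ⟨hq, hq2⟩ a b ha hb hab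
  refine ⟨?_, by simp [hp2, hq2]⟩
  simp
  have : a * p 0 + b * q 0 = a * p 0 + b * q 0 := rfl
  have hb' : b = 1 - a := by linarith
  subst hb'
  nlinarith [mul_nonneg ha hb, mul_nonneg (mul_nonneg ha hb) (add_nonneg (sq_nonneg (p 0 - q 0))
    (sq_nonneg (p 1 - q 1))), mul_le_mul_of_nonneg_left hp ha, mul_le_mul_of_nonneg_left hq hb]

theorem isCompact_discA : IsCompact discA := by
  refine Metric.isCompact_of_isClosed_isBounded ?_ ?_
  · have h1 : IsClosed {p : E3 | p 0 ^ 2 + (p 1 + 1 / 2) ^ 2 ≤ 1} :=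
      isClosed_le (by fun_prop) (by fun_prop)
    have h2 : IsClosed {p : E3 | p 2 = 0} := isClosed_eq (by fun_prop) (by fun_prop)
    exact h1.inter h2
  · refine isBounded_iff_forall_norm_le.2 ⟨2, fun p hp => ?_⟩
    have := norm_sq_eq p
    rw [hp.2] at this
    refine abs_le_of_sq_le_sq' ?_ two_pos.le |>.2
    nlinarith [hp.1, sq_nonneg (p 0), sq_nonneg (p 1 - 1 / 2)]

theorem discA_subset : discA ⊆ convexHull ℝ kA := by
  rintro p ⟨hp, hp2⟩
  have h1 : 0 ≤ 1 - (p 1 + 1 / 2) ^ 2 := by nlinarith [sq_nonneg (p 0)]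
  set w := √(1 - (p 1 + 1 / 2) ^ 2) with hw
  have hw2 : w ^ 2 = 1 - (p 1 + 1 / 2) ^ 2 := sq_sqrt h1
  have hw0 : 0 ≤ w := sqrt_nonneg _
  have hlw : |p 0| ≤ w := abs_le_sqrt (by linarith)
  obtain ⟨hl, hr⟩ := abs_le.1 hlw
  have hq : !₂[w, p 1, 0] ∈ kA := ⟨by simp; linarith, by simp⟩
  have hq' : !₂[-w, p 1, 0] ∈ kA := ⟨by simp; linarith, by simp⟩
  refine (convex_convexHull ℝ kA).segment_subset (subset_convexHull ℝ kA hq')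
    (subset_convexHull ℝ kA hq) ?_
  rcases hw0.eq_or_lt with h | h
  · have h0 : p 0 = 0 := by linarith
    refine ⟨1 / 2, 1 / 2, by norm_num, by norm_num, by norm_num, ?_⟩
    apply ext_three <;> simp [hp2, h0]
    ring
  · refine ⟨(w - p 0) / (2 * w), (w + p 0) / (2 * w), div_nonneg (by linarith) (by linarith),
      div_nonneg (by linarith) (by linarith), by field_simp; ring, ?_⟩
    apply ext_three <;> simp [hp2]
    · field_simp
      ring
    · field_simp
      ring

theorem kA_subset_discA : kA ⊆ discA := fun _ hp => ⟨hp.1.le, hp.2⟩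

theorem convexHull_kA : convexHull ℝ kA = discA :=
  (convexHull_min kA_subset_discA convex_discA).antisymm discA_subset

theorem swap_image_kA : swap '' kA = kB := by
  ext p
  constructor
  · rintro ⟨q, ⟨h1, h2⟩, rfl⟩
    exact ⟨by simp; linarith, by simpa using h2⟩
  · rintro ⟨h1, h2⟩
    exact ⟨swap p, ⟨by simp; linarith, by simpa using h2⟩, swap_swap p⟩

theorem convexHull_kB : convexHull ℝ kB = swap '' discA := by
  rw [← swap_image_kA, ← convexHull_kA]
  exact (LinearMap.image_convexHull swap.toLinearEquiv.toLinearMap kA).symm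

theorem kA_nonempty : kA.Nonempty := ⟨!₂[1, -1 / 2, 0], by simp; norm_num, by simp⟩

theorem mem_oloid_iff {p : E3} : p ∈ oloid ↔
    ∃ s ∈ Set.Icc (0 : ℝ) 1, ∃ α ∈ discA, ∃ β ∈ discA, p = (1 - s) • α + s • swap β := by
  rw [oloid, convexHull_union kA_nonempty (swap_image_kA ▸ kA_nonempty.image _), convexHull_kA,
    convexHull_kB, mem_convexJoin]
  simp only [Set.exists_mem_image, segment_eq_image]
  constructor
  · rintro ⟨α, hα, β, hβ, s, hs, rfl⟩
    exact ⟨s, hs, α, hα, β, hβ, rfl⟩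
  · rintro ⟨s, hs, α, hα, β, hβ, rfl⟩
    exact ⟨α, hα, β, hβ, s, hs, rfl⟩

theorem isCompact_oloid : IsCompact oloid := by
  have : oloid = (fun q : ℝ × E3 × E3 => (1 - q.1) • q.2.1 + q.1 • swap q.2.2) ''
      (Set.Icc 0 1 ×ˢ discA ×ˢ discA) := by
    ext p
    rw [mem_oloid_iff]
    constructor
    · rintro ⟨s, hs, α, hα, β, hβ, rfl⟩
      exact ⟨(s, α, β), ⟨hs, hα, hβ⟩, rfl⟩
    · rintro ⟨⟨s, α, β⟩, ⟨hs, hα, hβ⟩, rfl⟩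
      exact ⟨s, hs, α, hα, β, hβ, rfl⟩
  rw [this]
  refine (isCompact_Icc.prod (isCompact_discA.prod isCompact_discA)).image ?_
  have := swap.continuous
  fun_prop

theorem convex_oloid : Convex ℝ oloid := convex_convexHull ℝ _

theorem discA_subset_oloid : discA ⊆ oloid := by
  rw [← convexHull_kA]
  exact convexHull_mono Set.subset_union_left

/-! ### Support functions and faces -/

/-- The support function of the first disc. -/
def suppA (n : E3) : ℝ := -n 1 / 2 + √(n 0 ^ 2 + n 1 ^ 2)

/-- The point of the first circle that is extremal in the direction `n`. -/
def faceA (n : E3) : E3 :=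
  !₂[n 0 / √(n 0 ^ 2 + n 1 ^ 2), -1 / 2 + n 1 / √(n 0 ^ 2 + n 1 ^ 2), 0]

/-- The support function of the oloid. -/
def supp (n : E3) : ℝ := max (suppA n) (suppA (swap n))

theorem supp_swap (n : E3) : supp (swap n) = supp n := by
  rw [supp, supp, swap_swap, max_comm]

theorem inner_le_suppA {α : E3} (hα : α ∈ discA) (n : E3) : inner ℝ α n ≤ suppA n := by
  obtain ⟨h1, h2⟩ := hα
  rw [inner_eq, h2, suppA]
  have : α 0 * n 0 + (α 1 + 1 / 2) * n 1 ≤ √(n 0 ^ 2 + n 1 ^ 2) := by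
    refine le_sqrt_of_sq_le ?_
    nlinarith [sq_nonneg (α 0 * n 1 - (α 1 + 1 / 2) * n 0),
      mul_le_mul_of_nonneg_right h1 (add_nonneg (sq_nonneg (n 0)) (sq_nonneg (n 1)))]
  linarith

theorem faceA_mem_discA (n : E3) : faceA n ∈ discA := by
  refine ⟨?_, by simp [faceA]⟩
  have h : faceA n 1 + 1 / 2 = n 1 / √(n 0 ^ 2 + n 1 ^ 2) := by
    simp [faceA]
    ring
  rw [h]
  simp only [faceA, PiLp.toLp_apply, Matrix.cons_val_zero]
  rw [div_pow, div_pow, sq_sqrt (by positivity), ← add_div]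
  exact div_self_le_one _

theorem inner_faceA (n : E3) : inner ℝ (faceA n) n = suppA n := by
  rw [inner_eq, suppA]
  simp [faceA]
  set w := √(n 0 ^ 2 + n 1 ^ 2) with hw
  have hw2 : w ^ 2 = n 0 ^ 2 + n 1 ^ 2 := sq_sqrt (by positivity)
  rcases eq_or_ne w 0 with h | h
  · have h1 : n 1 = 0 := by
      rw [h] at hw2
      nlinarith [sq_nonneg (n 0), sq_nonneg (n 1)]
    simp [h, h1]
  · field_simp
    linarith

theorem eq_faceA {α n : E3} (hα : α ∈ discA) (hn : n 0 ^ 2 + n 1 ^ 2 ≠ 0)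
    (h : suppA n ≤ inner ℝ α n) : α = faceA n := by
  obtain ⟨h1, h2⟩ := hα
  rw [inner_eq, h2, suppA] at h
  have hpos : 0 < n 0 ^ 2 + n 1 ^ 2 := lt_of_le_of_ne (by positivity) hn.symm
  have hw0 : 0 < √(n 0 ^ 2 + n 1 ^ 2) := sqrt_pos.2 hpos
  have hw2 : √(n 0 ^ 2 + n 1 ^ 2) ^ 2 = n 0 ^ 2 + n 1 ^ 2 := sq_sqrt hpos.le
  have e0 : α 0 = faceA n 0 ∧ α 1 = faceA n 1 := by
    simp only [faceA, PiLp.toLp_apply, Matrix.cons_val_zero, Matrix.cons_val_one]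
    generalize √(n 0 ^ 2 + n 1 ^ 2) = w at *
    have h3 : w ≤ α 0 * n 0 + (α 1 + 1 / 2) * n 1 := by linarith
    have h4 : (w * α 0 - n 0) ^ 2 + (w * (α 1 + 1 / 2) - n 1) ^ 2 ≤ 0 := by
      nlinarith [mul_le_mul_of_nonneg_left h3 hw0.le,
        mul_le_mul_of_nonneg_left h1 (sq_nonneg w)]
    have h5 : w * α 0 - n 0 = 0 := by
      nlinarith [sq_nonneg (w * α 0 - n 0), sq_nonneg (w * (α 1 + 1 / 2) - n 1)]
    have h6 : w * (α 1 + 1 / 2) - n 1 = 0 := by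
      nlinarith [sq_nonneg (w * α 0 - n 0), sq_nonneg (w * (α 1 + 1 / 2) - n 1)]
    constructor
    · field_simp
      linarith
    · field_simp
      linarith
  exact ext_three e0.1 e0.2 (by simp [h2, faceA])

theorem inner_le_supp {p : E3} (hp : p ∈ oloid) (n : E3) : inner ℝ p n ≤ supp n := by
  obtain ⟨s, ⟨hs0, hs1⟩, α, hα, β, hβ, rfl⟩ := mem_oloid_iff.1 hp
  have h1 := inner_le_suppA hα n
  have h2 := inner_le_suppA hβ (swap n)
  have h3 : inner ℝ (swap β) n = inner ℝ β (swap n) := by simp [inner_eq]; ring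
  have h4 : suppA n ≤ supp n := le_max_left _ _
  have h5 : suppA (swap n) ≤ supp n := le_max_right _ _
  rw [inner_add_left, inner_smul_left, inner_smul_left, h3]
  simp
  nlinarith

theorem exists_inner_eq_supp (n : E3) : ∃ p ∈ oloid, inner ℝ p n = supp n := by
  rcases max_choice (suppA n) (suppA (swap n)) with h | h
  · exact ⟨faceA n, discA_subset_oloid (faceA_mem_discA n), by rw [inner_faceA, supp, h]⟩
  · refine ⟨swap (faceA (swap n)), swap_mem_oloid (discA_subset_oloid (faceA_mem_discA _)), ?_⟩
    rw [supp, h, ← inner_faceA, ← swap.inner_map_map (faceA (swap n)), swap_swap]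

/-- `n` is an outer normal vector of the oloid at `p`. -/
def IsNormal (p n : E3) : Prop := p ∈ oloid ∧ supp n ≤ inner ℝ p n

theorem IsNormal.swap {p n : E3} (h : IsNormal p n) : IsNormal (swap p) (swap n) :=
  ⟨swap_mem_oloid h.1, by rw [supp_swap, LinearIsometryEquiv.inner_map_map]; exact h.2⟩

theorem exists_isNormal (z : E3) :
    ∃ p, IsNormal p (z - p) ∧ ∀ w ∈ oloid, ‖z - p‖ ≤ ‖z - w‖ := by
  have hne : oloid.Nonempty := ⟨_, discA_subset_oloid (faceA_mem_discA 0)⟩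
  obtain ⟨p, hp, h⟩ := exists_norm_eq_iInf_of_complete_convex hne
    isCompact_oloid.isClosed.isComplete convex_oloid z
  have h2 := (norm_eq_iInf_iff_real_inner_le_zero convex_oloid hp).1 h
  refine ⟨p, ⟨hp, ?_⟩, fun w hw => ?_⟩
  · obtain ⟨w, hw, h3⟩ := exists_inner_eq_supp (z - p)
    have := h2 w hw
    rw [real_inner_comm, inner_sub_left] at this
    linarith
  · rw [h]
    exact ciInf_le ⟨0, by rintro _ ⟨w, rfl⟩; exact norm_nonneg _⟩ (⟨w, hw⟩ : oloid)

theorem mem_oloid_of_inner_le {y : E3} (h : ∀ n, inner ℝ y n ≤ supp n) : y ∈ oloid := by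
  obtain ⟨p, ⟨hp, hn⟩, -⟩ := exists_isNormal y
  have h1 := h (y - p)
  have h2 : inner ℝ (y - p) (y - p) = ‖y - p‖ ^ 2 := real_inner_self_eq_norm_sq _
  rw [inner_sub_left] at h2
  have : y - p = 0 := norm_eq_zero.1 (by nlinarith [norm_nonneg (y - p)])
  rwa [sub_eq_zero.1 this]

theorem IsNormal.eq_of_add_eq {p n p' n' : E3} (h : IsNormal p n) (h' : IsNormal p' n')
    (he : p + n = p' + n') : p = p' := by
  have h1 := (inner_le_supp h'.1 n).trans h.2
  have h2 := (inner_le_supp h.1 n').trans h'.2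
  have h3 : n = p' + n' - p := by rw [← he]; abel
  have h4 : inner ℝ (p' - p) (p' - p) = ‖p' - p‖ ^ 2 := real_inner_self_eq_norm_sq _
  have : p' - p = 0 := by
    refine norm_eq_zero.1 ?_
    subst h3
    simp only [inner_add_right, inner_sub_right, inner_sub_left] at h1 h2 h4
    nlinarith [norm_nonneg (p' - p), real_inner_comm p p']
  exact (sub_eq_zero.1 this).symm

theorem IsNormal.eq_faceA {p n : E3} (h : IsNormal p n) (hlt : suppA (Oloid.swap n) < suppA n) :
    p = faceA n ∧ n 0 ^ 2 + n 1 ^ 2 ≠ 0 := by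
  obtain ⟨hp, hn⟩ := h
  obtain ⟨s, ⟨hs0, hs1⟩, α, hα, β, hβ, rfl⟩ := mem_oloid_iff.1 hp
  have h1 := inner_le_suppA hα n
  have h2 := inner_le_suppA hβ (Oloid.swap n)
  have h3 : inner ℝ (Oloid.swap β) n = inner ℝ β (Oloid.swap n) := by simp [inner_eq]; ring
  rw [inner_add_left, inner_smul_left, inner_smul_left, h3, supp, max_eq_left hlt.le] at hn
  simp at hn
  have hs : s = 0 := by nlinarith
  subst hs
  have hn0 : n 0 ^ 2 + n 1 ^ 2 ≠ 0 := by
    intro h0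
    have h1 : n 1 = 0 := by nlinarith [sq_nonneg (n 0), sq_nonneg (n 1)]
    have h2 : suppA n = 0 := by
      rw [suppA, h0, h1]
      simp
    rw [h2] at hlt
    simp [suppA, h1, sqrt_sq_eq_abs] at hlt
    linarith [abs_nonneg (n 2)]
  refine ⟨?_, hn0⟩
  rw [← Oloid.eq_faceA hα hn0 (by linarith)]
  simp

theorem IsNormal.eq_segment {p n : E3} (h : IsNormal p n) (heq : suppA n = suppA (Oloid.swap n))
    (hn0 : n ≠ 0) : ∃ s ∈ Set.Icc (0 : ℝ) 1,
      p = (1 - s) • faceA n + s • Oloid.swap (faceA (Oloid.swap n)) := by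
  obtain ⟨hp, hn⟩ := h
  obtain ⟨s, ⟨hs0, hs1⟩, α, hα, β, hβ, rfl⟩ := mem_oloid_iff.1 hp
  have h1 := inner_le_suppA hα n
  have h2 := inner_le_suppA hβ (Oloid.swap n)
  have h3 : inner ℝ (Oloid.swap β) n = inner ℝ β (Oloid.swap n) := by simp [inner_eq]; ring
  rw [inner_add_left, inner_smul_left, inner_smul_left, h3, supp, ← heq, max_self] at hn
  simp at hn
  rw [← heq] at h2
  have hA : n 0 ^ 2 + n 1 ^ 2 ≠ 0 := by
    intro h0
    have e1 : n 1 = 0 := by nlinarith [sq_nonneg (n 0), sq_nonneg (n 1)]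
    have e0 : n 0 = 0 := by nlinarith [sq_nonneg (n 0), sq_nonneg (n 1)]
    have h4 : suppA n = 0 := by simp [suppA, e0, e1]
    rw [h4] at heq
    simp [suppA, e1, sqrt_sq_eq_abs] at heq
    exact hn0 (ext_three (by simp [e0]) (by simp [e1]) (by simpa using heq.symm))
  have hB : Oloid.swap n 0 ^ 2 + Oloid.swap n 1 ^ 2 ≠ 0 := by
    intro h0
    simp at h0
    have e1 : n 1 = 0 := by nlinarith [sq_nonneg (n 2), sq_nonneg (n 1)]
    have e2 : n 2 = 0 := by nlinarith [sq_nonneg (n 2), sq_nonneg (n 1)]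
    have h4 : suppA (Oloid.swap n) = 0 := by simp [suppA, e2, e1]
    rw [h4] at heq
    simp [suppA, e1, sqrt_sq_eq_abs] at heq
    exact hn0 (ext_three (by simpa using heq) (by simp [e1]) (by simp [e2]))
  refine ⟨s, ⟨hs0, hs1⟩, ?_⟩
  have hα' : (1 - s) • α = (1 - s) • faceA n := by
    rcases hs1.eq_or_lt with h | h
    · simp [h]
    · rw [Oloid.eq_faceA hα hA (by nlinarith)]
  have hβ2 : s • Oloid.swap β = s • Oloid.swap (faceA (Oloid.swap n)) := by
    rcases hs0.eq_or_lt with h | h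
    · simp [← h]
    · rw [Oloid.eq_faceA hβ hB (by nlinarith)]
  rw [hα', hβ2]

/-! ### Homogeneity -/

theorem sqrt_smul {r : ℝ} (hr : 0 ≤ r) (n : E3) :
    √((r • n) 0 ^ 2 + (r • n) 1 ^ 2) = r * √(n 0 ^ 2 + n 1 ^ 2) := by
  rw [← sqrt_sq hr, ← sqrt_mul (sq_nonneg r), sqrt_sq hr]
  congr 1
  simp
  ring

theorem suppA_smul {r : ℝ} (hr : 0 ≤ r) (n : E3) : suppA (r • n) = r * suppA n := by
  rw [suppA, sqrt_smul hr, suppA]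
  simp
  ring

theorem supp_smul {r : ℝ} (hr : 0 ≤ r) (n : E3) : supp (r • n) = r * supp n := by
  rw [supp, map_smul, suppA_smul hr, suppA_smul hr, supp, mul_max_of_nonneg _ _ hr]

theorem IsNormal.smul {p n : E3} (h : IsNormal p n) {r : ℝ} (hr : 0 ≤ r) : IsNormal p (r • n) := by
  refine ⟨h.1, ?_⟩
  rw [supp_smul hr, inner_smul_right]
  exact mul_le_mul_of_nonneg_left h.2 hr

theorem IsNormal.of_smul {p n : E3} {r : ℝ} (hr : 0 < r) (h : IsNormal p (r • n)) :
    IsNormal p n := by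
  have := h.smul (inv_nonneg.2 hr.le)
  rwa [smul_smul, inv_mul_cancel₀ hr.ne', one_smul] at this

theorem isNormal_faceA {n : E3} (h : suppA (Oloid.swap n) ≤ suppA n) : IsNormal (faceA n) n :=
  ⟨discA_subset_oloid (faceA_mem_discA n), by rw [inner_faceA, supp, max_eq_left h]⟩

/-! ### The ruled surface -/

/-- The point of the first circle with parameter `x`. -/
def ptA (x : ℝ) : E3 := !₂[2 * sS x * cC x, 1 / 2 - 2 * cC x ^ 2, 0]

/-- The point of the second circle with parameter `x`. -/
def ptB (x : ℝ) : E3 := !₂[0, 2 * dD x ^ 2 - 1 / 2, 2 * tT x * dD x]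

/-- The common unit normal along the segment from `ptA x` to `ptB x`. -/
def nrm (x : ℝ) : E3 := !₂[sS x, dD x - cC x, tT x]

theorem sqrt_nrm (x : ℝ) : √(nrm x 0 ^ 2 + nrm x 1 ^ 2) = dD x := by
  rw [← sqrt_sq (dD_pos x).le]
  congr 1
  simp [nrm]
  linear_combination sS_sq x - cC_mul_dD x

theorem sqrt_swap_nrm (x : ℝ) : √(swap (nrm x) 0 ^ 2 + swap (nrm x) 1 ^ 2) = cC x := by
  rw [← sqrt_sq (cC_pos x).le]
  congr 1
  simp [nrm]
  linear_combination tT_sq x - cC_mul_dD x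

theorem suppA_nrm (x : ℝ) : suppA (nrm x) = (cC x + dD x) / 2 := by
  rw [suppA, sqrt_nrm]
  simp [nrm]
  ring

theorem suppA_swap_nrm (x : ℝ) : suppA (swap (nrm x)) = (cC x + dD x) / 2 := by
  rw [suppA, sqrt_swap_nrm]
  simp [nrm]
  ring

theorem supp_nrm (x : ℝ) : supp (nrm x) = (cC x + dD x) / 2 := by
  rw [supp, suppA_nrm, suppA_swap_nrm, max_self]

theorem faceA_nrm (x : ℝ) : faceA (nrm x) = ptA x := by
  have h1 := cC_mul_dD x
  have h2 := (dD_pos x).ne'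
  rw [faceA, sqrt_nrm]
  apply ext_three <;> simp [nrm, ptA] <;> field_simp <;> grind

theorem swap_faceA_swap_nrm (x : ℝ) : swap (faceA (swap (nrm x))) = ptB x := by
  have h1 := cC_mul_dD x
  have h2 := (cC_pos x).ne'
  rw [faceA, sqrt_swap_nrm]
  apply ext_three <;> simp [nrm, ptB] <;> field_simp <;> grind

theorem norm_nrm (x : ℝ) : ‖nrm x‖ = 1 := by
  rw [← sq_eq_sq₀ (norm_nonneg _) zero_le_one, norm_sq_eq]
  simp [nrm]
  linear_combination sS_sq x + tT_sq x - cC_mul_dD x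

theorem isNormal_segment {s : ℝ} (hs : s ∈ Set.Icc (0 : ℝ) 1) (x : ℝ) :
    IsNormal ((1 - s) • ptA x + s • ptB x) (nrm x) := by
  rw [← faceA_nrm, ← swap_faceA_swap_nrm]
  refine ⟨mem_oloid_iff.2 ⟨s, hs, _, faceA_mem_discA _, _, faceA_mem_discA _, rfl⟩, ?_⟩
  have h3 : inner ℝ (swap (faceA (swap (nrm x)))) (nrm x) = suppA (swap (nrm x)) := by
    rw [← inner_faceA, ← swap.inner_map_map (faceA _), swap_swap]
  rw [inner_add_left, inner_smul_left, inner_smul_left, inner_faceA, h3, suppA_nrm,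
    suppA_swap_nrm, supp_nrm]
  simp
  linarith

theorem exists_sS_eq {a : ℝ} (h0 : 0 < a) (h1 : a ^ 2 < 3 / 4) :
    ∃ x ∈ Set.Ioo 0 (π / 2), sS x = a := by
  have h3 : (0 : ℝ) < √3 := by positivity
  have h33 : √3 ^ 2 = (3 : ℝ) := sq_sqrt (by norm_num)
  have hpos : 0 < 2 * a / √3 := by positivity
  have hlt : 2 * a / √3 < 1 := by
    rw [div_lt_one h3]
    refine lt_of_pow_lt_pow_left₀ 2 h3.le ?_
    linarith
  refine ⟨arcsin (2 * a / √3), ⟨arcsin_pos.2 hpos, arcsin_lt_pi_div_two.2 hlt⟩, ?_⟩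
  rw [sS, sin_arcsin (by linarith) hlt.le]
  field_simp

theorem exists_nrm_eq {n : E3} (hn : ‖n‖ = 1) (h0 : 0 < n 0) (h2 : 0 < n 2)
    (heq : suppA n = suppA (swap n)) : ∃ x ∈ Set.Ioo 0 (π / 2), n = nrm x := by
  have hn2 := norm_sq_eq n
  rw [hn, one_pow] at hn2
  simp only [suppA, swap_zero, swap_one, neg_sq, neg_neg] at heq
  have hd2 : √(n 0 ^ 2 + n 1 ^ 2) ^ 2 = n 0 ^ 2 + n 1 ^ 2 := sq_sqrt (by positivity)
  have hc2 : √(n 2 ^ 2 + n 1 ^ 2) ^ 2 = n 2 ^ 2 + n 1 ^ 2 := sq_sqrt (by positivity)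
  have hd0 : 0 < √(n 0 ^ 2 + n 1 ^ 2) := sqrt_pos.2 (by positivity)
  have hc0 : 0 < √(n 2 ^ 2 + n 1 ^ 2) := sqrt_pos.2 (by positivity)
  generalize √(n 0 ^ 2 + n 1 ^ 2) = d at *
  generalize √(n 2 ^ 2 + n 1 ^ 2) = c at *
  have h1 : n 1 = d - c := by linarith
  have hcd : 2 * (c * d) = 1 := by
    rw [h1] at hd2 hc2 hn2
    nlinarith
  have hd1 : d < 1 := by nlinarith
  have hc : 1 / 2 < c := by nlinarith
  obtain ⟨x, hx, hxS⟩ := exists_sS_eq h0 (by nlinarith)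
  have hxc : cC x = c := by
    rw [← sq_eq_sq₀ (cC_pos x).le hc0.le]
    have := sS_sq x
    rw [hxS] at this
    linarith
  have hxd : dD x = d := by
    have := cC_mul_dD x
    rw [hxc] at this
    have h4 : c * dD x = c * d := by linarith
    exact mul_left_cancel₀ hc0.ne' h4
  have hxT : tT x = n 2 := by
    rw [← sq_eq_sq₀ (tT_pos hx).le h2.le, tT_sq, hxd]
    linarith
  exact ⟨x, hx, ext_three (by simp [nrm, hxS]) (by simp [nrm, hxd, hxc, h1]) (by simp [nrm, hxT])⟩

theorem ptA_injOn : Set.InjOn ptA (Set.Ioo 0 (π / 2)) := fun x hx y hy h => by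
  have h1 : ptA x 1 = ptA y 1 := by rw [h]
  simp [ptA] at h1
  refine sS_injOn hx hy ?_
  have h1 : sS x ^ 2 = sS y ^ 2 := by
    rw [sS_sq, sS_sq]
    linarith
  exact (sq_eq_sq₀ (sS_pos hx).le (sS_pos hy).le).1 h1

theorem segment_inj {x s s' : ℝ} (hx : x ∈ Set.Ioo 0 (π / 2))
    (h : (1 - s) • ptA x + s • ptB x = (1 - s') • ptA x + s' • ptB x) : s = s' := by
  have h1 : ((1 - s) • ptA x + s • ptB x) 2 = ((1 - s') • ptA x + s' • ptB x) 2 := by rw [h]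
  have h2 := tT_pos hx
  have h3 := dD_pos x
  have h4 : s * (2 * tT x * dD x) = s' * (2 * tT x * dD x) := by simpa [ptA, ptB] using h1
  exact mul_right_cancel₀ (by positivity) h4

/-- The open quadrant `x > 0`, `z > 0`. -/
def quadrant : Set E3 := {p | 0 < p 0 ∧ 0 < p 2}

/-! ### The cone -/

theorem coneMap_eq (x s ρ : ℝ) : coneMap (x, s, ρ) = ρ • ((1 - s) • ptA x + s • ptB x) := by
  apply ext_three <;> simp [coneMap, ptA, ptB, -mul_eq_mul_left_iff] <;> ring

theorem zero_mem_oloid : (0 : E3) ∈ oloid := discA_subset_oloid (by norm_num [discA])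

theorem supp_pos {n : E3} (hn : n ≠ 0) : 0 < supp n := by
  have h1 : |n 1| ≤ √(n 0 ^ 2 + n 1 ^ 2) := abs_le_sqrt (by linarith [sq_nonneg (n 0)])
  have h2 : |n 1| ≤ √(n 2 ^ 2 + n 1 ^ 2) := abs_le_sqrt (by linarith [sq_nonneg (n 2)])
  have h3 : suppA n ≤ supp n := le_max_left _ _
  have h4 : suppA (swap n) ≤ supp n := le_max_right _ _
  simp [suppA] at h3 h4
  by_contra! h
  have h5 := le_abs_self (n 1)
  have h6 := neg_le_abs (n 1)
  have h7 : n 1 = 0 := by linarith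
  rw [h7] at h3 h4
  simp at h3 h4
  have h8 : √(n 0 ^ 2) = 0 := le_antisymm (by linarith) (sqrt_nonneg _)
  have h9 : √(n 2 ^ 2) = 0 := le_antisymm (by linarith) (sqrt_nonneg _)
  rw [sqrt_sq_eq_abs, abs_eq_zero] at h8 h9
  exact hn (ext_three (by simpa using h8) (by simpa using h7) (by simpa using h9))

theorem continuous_suppA : Continuous suppA := by
  unfold suppA
  fun_prop

theorem continuous_supp : Continuous supp :=
  continuous_suppA.max (continuous_suppA.comp swap.continuous)

theorem exists_smul_isNormal {z : E3} (hz : z ∈ oloid) (hz0 : z ≠ 0) :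
    ∃ ρ ∈ Set.Ioc (0 : ℝ) 1, ∃ y n, ‖n‖ = 1 ∧ IsNormal y n ∧ z = ρ • y := by
  have hne : (Metric.sphere (0 : E3) 1).Nonempty := ⟨‖z‖⁻¹ • z, by simp [norm_smul, hz0]⟩
  have hsph : ∀ n ∈ Metric.sphere (0 : E3) 1, n ≠ 0 := fun n hn h => by simp [h] at hn
  have hcont : ContinuousOn (fun n => inner ℝ z n / supp n) (Metric.sphere (0 : E3) 1) :=
    ContinuousOn.div (by fun_prop) continuous_supp.continuousOn fun n hn =>
      (supp_pos (hsph n hn)).ne'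
  obtain ⟨n, hn, hmax⟩ := (isCompact_sphere (0 : E3) 1).exists_isMaxOn hne hcont
  have hsn := supp_pos (hsph n hn)
  set ρ := inner ℝ z n / supp n with hρ
  have hle : ∀ w : E3, inner ℝ z w ≤ ρ * supp w := by
    intro w
    rcases eq_or_ne w 0 with rfl | hw
    · simp [supp, suppA]
    · have hw0 : 0 < ‖w‖ := norm_pos_iff.2 hw
      have h1 : inner ℝ z (‖w‖⁻¹ • w) / supp (‖w‖⁻¹ • w) ≤ ρ :=
        hmax (show ‖w‖⁻¹ • w ∈ Metric.sphere (0 : E3) 1 by simp [norm_smul, hw])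
      rwa [supp_smul (by positivity), inner_smul_right,
        mul_div_mul_left _ _ (by positivity : ‖w‖⁻¹ ≠ 0), div_le_iff₀ (supp_pos hw)] at h1
  have hρ0 : 0 < ρ := by
    have h1 := hle z
    rw [real_inner_self_eq_norm_sq] at h1
    have h2 : 0 < ‖z‖ := norm_pos_iff.2 hz0
    exact pos_of_mul_pos_left (lt_of_lt_of_le (by positivity) h1) (supp_pos hz0).le
  have hρ1 : ρ ≤ 1 := (div_le_one hsn).2 (inner_le_supp hz n)
  refine ⟨ρ, ⟨hρ0, hρ1⟩, ρ⁻¹ • z, n, by simpa using hn, ⟨mem_oloid_of_inner_le fun w => ?_, ?_⟩, ?_⟩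
  · rw [real_inner_smul_left, inv_mul_le_iff₀ hρ0]
    exact hle w
  · rw [real_inner_smul_left, le_inv_mul_iff₀ hρ0, hρ]
    field_simp
    exact le_rfl
  · rw [smul_smul, mul_inv_cancel₀ hρ0.ne', one_smul]

theorem image_coneMap : coneMap '' (Set.Ioo 0 (π / 2) ×ˢ Set.Ioo 0 1 ×ˢ Set.Ioc 0 1) =
    oloid ∩ quadrant := by
  ext z
  constructor
  · rintro ⟨⟨x, s, ρ⟩, ⟨hx, ⟨hs0, hs1⟩, hρ0, hρ1⟩, rfl⟩
    constructor
    · rw [coneMap_eq]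
      exact convex_oloid.smul_mem_of_zero_mem zero_mem_oloid
        (isNormal_segment ⟨hs0.le, hs1.le⟩ x).1 ⟨hρ0.le, hρ1⟩
    · have h1 := tT_pos hx
      have h2 := dD_pos x
      have h3 := sS_pos hx
      have h4 := cC_pos x
      have h5 : 0 < 1 + -s := by linarith
      simp only [quadrant, coneMap, Set.mem_ofPred_eq]
      constructor <;> simp <;> positivity
  · rintro ⟨hz, hz0, hz2⟩
    obtain ⟨ρ, ⟨hρ0, hρ1⟩, y, n, hn, hy, rfl⟩ :=
      exists_smul_isNormal hz (by rintro rfl; simp at hz0)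
    simp only [PiLp.smul_apply, smul_eq_mul, mul_pos_iff_of_pos_left hρ0] at hz0 hz2
    have heq : suppA n = suppA (swap n) := by
      rcases lt_trichotomy (suppA n) (suppA (swap n)) with h | h | h
      · have := (hy.swap.eq_faceA (by rwa [swap_swap])).1
        have h0 : swap y 2 = 0 := by rw [this]; simp [faceA]
        simp at h0
        linarith
      · exact h
      · have h0 : y 2 = 0 := by rw [(hy.eq_faceA h).1]; simp [faceA]
        linarith
    have hn0 : n ≠ 0 := by rintro rfl; simp at hn
    obtain ⟨s, ⟨hs0, hs1⟩, hys⟩ := hy.eq_segment heq hn0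
    have e0 : 0 < (1 - s) * (n 0 / √(n 0 ^ 2 + n 1 ^ 2)) := by
      rw [hys] at hz0
      simpa [faceA] using hz0
    have e2 : 0 < s * (n 2 / √(n 2 ^ 2 + n 1 ^ 2)) := by
      rw [hys] at hz2
      simpa [faceA] using hz2
    have hn0' : 0 < n 0 := by
      have h1 := pos_of_mul_pos_right e0 (by linarith)
      by_contra! h
      exact absurd h1 (div_nonpos_of_nonpos_of_nonneg h (sqrt_nonneg _)).not_gt
    have hn2' : 0 < n 2 := by
      have h1 := pos_of_mul_pos_right e2 hs0
      by_contra! h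
      exact absurd h1 (div_nonpos_of_nonpos_of_nonneg h (sqrt_nonneg _)).not_gt
    obtain ⟨x, hx, rfl⟩ := exists_nrm_eq hn hn0' hn2' heq
    refine ⟨(x, s, ρ), ⟨hx, ⟨?_, ?_⟩, hρ0, hρ1⟩, ?_⟩
    · refine lt_of_le_of_ne hs0 ?_
      rintro rfl
      simp at e2
    · refine lt_of_le_of_ne hs1 ?_
      rintro rfl
      simp at e0
    · rw [coneMap_eq, hys, faceA_nrm, swap_faceA_swap_nrm]

theorem injOn_coneMap : Set.InjOn coneMap (Set.Ioo 0 (π / 2) ×ˢ Set.Ioo 0 1 ×ˢ Set.Ioc 0 1) := by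
  rintro ⟨x, s, ρ⟩ ⟨hx, hs, hρ⟩ ⟨x', s', ρ'⟩ ⟨hx', hs', hρ'⟩ h
  simp only at hx hs hρ hx' hs' hρ'
  rw [coneMap_eq, coneMap_eq] at h
  have hle : ∀ {x s ρ x' s' ρ' : ℝ}, s ∈ Set.Ioo (0 : ℝ) 1 → s' ∈ Set.Ioo (0 : ℝ) 1 → 0 ≤ ρ' →
      ρ • ((1 - s) • ptA x + s • ptB x) = ρ' • ((1 - s') • ptA x' + s' • ptB x') → ρ ≤ ρ' := by
    intro x s ρ x' s' ρ' hs hs' hρ' h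
    have h1 := (isNormal_segment ⟨hs.1.le, hs.2.le⟩ x).2
    have h0 := inner_le_supp (isNormal_segment ⟨hs.1.le, hs.2.le⟩ x).1 (nrm x)
    have h2 := inner_le_supp (isNormal_segment ⟨hs'.1.le, hs'.2.le⟩ x').1 (nrm x)
    have h3 : 0 < supp (nrm x) := supp_pos fun h => by simpa [h] using norm_nrm x
    have h4 : inner ℝ (ρ • ((1 - s) • ptA x + s • ptB x)) (nrm x)
      = inner ℝ (ρ' • ((1 - s') • ptA x' + s' • ptB x')) (nrm x) := by rw [h]
    rw [real_inner_smul_left, real_inner_smul_left, le_antisymm h0 h1] at h4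
    nlinarith
  obtain rfl : ρ = ρ' := le_antisymm (hle hs hs' hρ'.1.le h) (hle hs' hs hρ.1.le h.symm)
  have h5 := smul_right_injective _ hρ.1.ne' h
  have h6 := (isNormal_segment ⟨hs'.1.le, hs'.2.le⟩ x').2
  rw [← h5, inner_add_left, real_inner_smul_left, real_inner_smul_left] at h6
  have hA : ptA x ∈ discA := faceA_nrm x ▸ faceA_mem_discA _
  have hB : ptB x ∈ oloid := swap_faceA_swap_nrm x ▸ swap_mem_oloid
    (discA_subset_oloid (faceA_mem_discA _))
  have h7 := inner_le_supp (discA_subset_oloid hA) (nrm x')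
  have h8 := inner_le_supp hB (nrm x')
  have h9 : suppA (nrm x') ≤ inner ℝ (ptA x) (nrm x') := by
    have : supp (nrm x') ≤ inner ℝ (ptA x) (nrm x') := by nlinarith [hs.1, hs.2]
    exact (le_max_left _ _).trans this
  have hne : nrm x' 0 ^ 2 + nrm x' 1 ^ 2 ≠ 0 := by
    have := sS_pos hx'
    simp [nrm]
    positivity
  have h10 := eq_faceA hA hne h9
  rw [faceA_nrm] at h10
  obtain rfl := ptA_injOn hx hx' h10
  rw [segment_inj hx h5]

/-! ### The layer around the oloid -/

/-- The closed parallel body of the oloid at distance one. -/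
def parallelBody : Set E3 := {z | ∃ p ∈ oloid, ‖z - p‖ ≤ 1}

/-- The points of the quadrant in the layer around the oloid whose normal `n` is such that the
support numbers of the two discs in direction `n` are related by `R`. -/
def layer (R : ℝ → ℝ → Prop) : Set E3 :=
  {z | z ∈ quadrant ∧ ∃ p n, IsNormal p n ∧ n ≠ 0 ∧ ‖n‖ ≤ 1 ∧ z = p + n ∧
    R (suppA n) (suppA (swap n))}

theorem parallelBody_inter_quadrant : parallelBody ∩ quadrant =
    oloid ∩ quadrant ∪ (layer (· = ·) ∪ (layer (· > ·) ∪ layer (· < ·))) := by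
  ext z
  constructor
  · rintro ⟨⟨w, hw, hwz⟩, hq⟩
    by_cases hz : z ∈ oloid
    · exact Or.inl ⟨hz, hq⟩
    · obtain ⟨p, hn, hp⟩ := exists_isNormal z
      have h0 : z - p ≠ 0 := fun h => hz (sub_eq_zero.1 h ▸ hn.1)
      have h1 := (hp w hw).trans hwz
      have h2 : z = p + (z - p) := by abel
      right
      rcases lt_trichotomy (suppA (z - p)) (suppA (swap (z - p))) with h | h | h
      · exact Or.inr (Or.inr ⟨hq, p, _, hn, h0, h1, h2, h⟩)
      · exact Or.inl ⟨hq, p, _, hn, h0, h1, h2, h⟩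
      · exact Or.inr (Or.inl ⟨hq, p, _, hn, h0, h1, h2, h⟩)
  · have key : ∀ R, layer R ⊆ parallelBody ∩ quadrant := by
      rintro R _ ⟨hq, p, n, hp, -, hn, rfl, -⟩
      exact ⟨⟨p, hp.1, by simpa using hn⟩, hq⟩
    rintro (⟨hz, hq⟩ | h | h | h)
    · exact ⟨⟨z, hz, by simp⟩, hq⟩
    all_goals exact key _ h

theorem disjoint_oloid_layer (R : ℝ → ℝ → Prop) : Disjoint (oloid ∩ quadrant) (layer R) := by
  refine Set.disjoint_left.2 ?_
  rintro _ ⟨hz, -⟩ ⟨-, p, n, hp, hn, -, rfl, -⟩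
  have h1 := inner_le_supp hz n
  rw [inner_add_left, real_inner_self_eq_norm_sq] at h1
  have h2 := hp.2
  have h3 : 0 < ‖n‖ := norm_pos_iff.2 hn
  nlinarith

theorem disjoint_layer {R R' : ℝ → ℝ → Prop} (h : ∀ a b, R a b → ¬ R' a b) :
    Disjoint (layer R) (layer R') := by
  refine Set.disjoint_left.2 ?_
  rintro _ ⟨-, p, n, hp, -, -, rfl, hR⟩ ⟨-, p', n', hp', -, -, he, hR'⟩
  obtain rfl := hp.eq_of_add_eq hp' he
  obtain rfl := add_left_cancel he
  exact h _ _ hR hR'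

theorem swap_mem_quadrant {z : E3} (hz : z ∈ quadrant) : swap z ∈ quadrant :=
  ⟨by simpa using hz.2, by simpa using hz.1⟩

theorem swap_image_layer (R : ℝ → ℝ → Prop) : swap '' layer R = layer fun a b => R b a := by
  have key : ∀ R z, z ∈ layer R → swap z ∈ layer fun a b => R b a := by
    rintro R _ ⟨hq, p, n, hp, hn, hn1, rfl, hR⟩
    exact ⟨swap_mem_quadrant hq, swap p, swap n, hp.swap, by simpa using hn, by simpa using hn1,
      map_add _ _ _, by simpa using hR⟩
  ext z
  constructor
  · rintro ⟨w, hw, rfl⟩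
    exact key R w hw
  · exact fun hz => ⟨swap z, key _ z hz, swap_swap z⟩

theorem slabMap_eq (x s ρ : ℝ) :
    slabMap (x, s, ρ) = ((1 - s) • ptA x + s • ptB x) + ρ • nrm x := by
  apply ext_three <;>
    simp [slabMap, ptA, ptB, nrm, -mul_eq_mul_left_iff, -mul_eq_mul_right_iff] <;> ring

theorem exists_smul_unit {n : E3} (hn : n ≠ 0) (hn1 : ‖n‖ ≤ 1) :
    ∃ (ρ : ℝ) (N : E3), 0 < ρ ∧ ρ ≤ 1 ∧ ‖N‖ = 1 ∧ n = ρ • N := by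
  have h : 0 < ‖n‖ := norm_pos_iff.2 hn
  exact ⟨‖n‖, ‖n‖⁻¹ • n, h, hn1, by rw [norm_smul, norm_inv, norm_norm, inv_mul_cancel₀ h.ne'],
    by rw [smul_smul, mul_inv_cancel₀ h.ne', one_smul]⟩

theorem image_slabMap : slabMap '' (Set.Ioo 0 (π / 2) ×ˢ Set.Icc 0 1 ×ˢ Set.Ioc 0 1) =
    layer (· = ·) := by
  ext z
  constructor
  · rintro ⟨⟨x, s, ρ⟩, ⟨hx, ⟨hs0, hs1⟩, hρ0, hρ1⟩, rfl⟩
    simp only at hx hs0 hs1 hρ0 hρ1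
    refine ⟨?_, _, ρ • nrm x, (isNormal_segment ⟨hs0, hs1⟩ x).smul hρ0.le, ?_, ?_,
      slabMap_eq x s ρ, ?_⟩
    · have h1 := tT_pos hx
      have h2 := dD_pos x
      have h3 := sS_pos hx
      have h4 := cC_pos x
      have h5 : 0 ≤ 1 + -s := by linarith
      simp only [quadrant, slabMap, Set.mem_ofPred_eq]
      constructor <;> simp <;> positivity
    · refine smul_ne_zero hρ0.ne' fun h => ?_
      simpa [h] using norm_nrm x
    · rw [norm_smul, norm_nrm, norm_of_nonneg hρ0.le]
      linarith
    · rw [map_smul, suppA_smul hρ0.le, suppA_smul hρ0.le, suppA_nrm, suppA_swap_nrm]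
  · rintro ⟨⟨hq0, hq2⟩, p, n, hp, hn0, hn1, rfl, heq⟩
    have hn : 0 < ‖n‖ := norm_pos_iff.2 hn0
    obtain ⟨ρ, N, hρ, hρ1, hN, rfl⟩ := exists_smul_unit hn0 hn1
    replace hp := hp.of_smul hρ
    rw [map_smul, suppA_smul hρ.le, suppA_smul hρ.le, mul_right_inj' hρ.ne'] at heq
    obtain ⟨s, hs, rfl⟩ := hp.eq_segment heq (by rintro rfl; simp at hN)
    simp [faceA] at hq0 hq2
    have h1 : 0 ≤ 1 - s := by linarith [hs.2]
    have h0 : 0 < N 0 := by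
      by_contra! h
      have h3 := mul_nonpos_of_nonneg_of_nonpos h1
        (div_nonpos_of_nonpos_of_nonneg h (sqrt_nonneg (N 0 ^ 2 + N 1 ^ 2)))
      nlinarith
    have h2 : 0 < N 2 := by
      by_contra! h
      have h3 := mul_nonpos_of_nonneg_of_nonpos hs.1
        (div_nonpos_of_nonpos_of_nonneg h (sqrt_nonneg (N 2 ^ 2 + N 1 ^ 2)))
      nlinarith
    obtain ⟨x, hx, rfl⟩ := exists_nrm_eq hN h0 h2 heq
    exact ⟨(x, s, ρ), ⟨hx, hs, hρ, hρ1⟩, by rw [slabMap_eq, faceA_nrm, swap_faceA_swap_nrm]⟩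

theorem injOn_slabMap : Set.InjOn slabMap (Set.Ioo 0 (π / 2) ×ˢ Set.Icc 0 1 ×ˢ Set.Ioc 0 1) := by
  rintro ⟨x, s, ρ⟩ ⟨hx, hs, hρ⟩ ⟨x', s', ρ'⟩ ⟨hx', hs', hρ'⟩ h
  simp only at hx hs hρ hx' hs' hρ'
  rw [slabMap_eq, slabMap_eq] at h
  have h1 := ((isNormal_segment hs x).smul hρ.1.le).eq_of_add_eq
    ((isNormal_segment hs' x').smul hρ'.1.le) h
  rw [h1] at h
  have h2 := add_left_cancel h
  have h3 : ‖ρ • nrm x‖ = ‖ρ' • nrm x'‖ := by rw [h2]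
  rw [norm_smul, norm_smul, norm_nrm, norm_nrm, norm_of_nonneg hρ.1.le, norm_of_nonneg hρ'.1.le,
    mul_one, mul_one] at h3
  subst h3
  have h4 : nrm x = nrm x' := smul_right_injective _ hρ.1.ne' h2
  have h5 : nrm x 0 = nrm x' 0 := by rw [h4]
  obtain rfl := sS_injOn hx hx' (by simpa [nrm] using h5)
  rw [segment_inj hx h1]

/-- The unit normals at `ptA x`. -/
def tubeNrm (x φ : ℝ) : E3 := !₂[cos φ * (2 * sS x * cC x), cos φ * (1 - 2 * cC x ^ 2), sin φ]

theorem tubeMap_eq (x s ρ : ℝ) : tubeMap (x, s, ρ) = ptA x + ρ • tubeNrm x (s * vV x) := by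
  apply ext_three <;>
    simp [tubeMap, ptA, tubeNrm, -mul_eq_mul_left_iff, -mul_eq_mul_right_iff] <;> ring

theorem norm_tubeNrm (x φ : ℝ) : ‖tubeNrm x φ‖ = 1 := by
  rw [← sq_eq_sq₀ (norm_nonneg _) zero_le_one, norm_sq_eq]
  simp [tubeNrm, mul_pow]
  rw [sS_sq]
  linear_combination sin_sq_add_cos_sq φ

theorem sqrt_tubeNrm {x φ : ℝ} (hφ : 0 ≤ cos φ) :
    √(tubeNrm x φ 0 ^ 2 + tubeNrm x φ 1 ^ 2) = cos φ := by
  rw [← sqrt_sq hφ]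
  congr 1
  simp [tubeNrm, mul_pow]
  rw [sS_sq]
  ring

theorem faceA_tubeNrm {x φ : ℝ} (hφ : 0 < cos φ) : faceA (tubeNrm x φ) = ptA x := by
  rw [faceA, sqrt_tubeNrm hφ.le]
  apply ext_three <;> simp [tubeNrm, ptA] <;> field_simp
  ring

theorem suppA_swap_tubeNrm_lt {x φ : ℝ} (hφ : dD x < cos φ) :
    suppA (swap (tubeNrm x φ)) < suppA (tubeNrm x φ) := by
  have hd := dD_pos x
  have hc := cC_pos x
  have h1 := cC_mul_dD x
  have h2 := sin_sq_add_cos_sq φ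
  have hcos : 0 < cos φ := hd.trans hφ
  have h3 : √(sin φ ^ 2 + (cos φ * (1 - 2 * cC x ^ 2)) ^ 2) < 2 * cC x ^ 2 * cos φ := by
    rw [sqrt_lt' (by positivity)]
    have h4 : 1 < 2 * (cC x * cos φ) := by nlinarith
    nlinarith
  rw [suppA, suppA, sqrt_tubeNrm hcos.le]
  simp [tubeNrm] at h3 ⊢
  linarith

theorem tube_angle {x s : ℝ} (hx : x ∈ Set.Ioo 0 (π / 2)) (hs : s ∈ Set.Ioo (0 : ℝ) 1) :
    dD x < cos (s * vV x) ∧ 0 < sin (s * vV x) := by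
  have h1 := vV_pos hx
  have h2 := vV_lt x
  have h3 := pi_pos
  have h4 : 0 < s * vV x := mul_pos hs.1 h1
  have h5 : s * vV x < vV x := by nlinarith [hs.2]
  constructor
  · rw [← cos_vV]
    exact cos_lt_cos_of_nonneg_of_le_pi h4.le (by linarith) h5
  · exact sin_pos_of_pos_of_lt_pi h4 (by linarith)

theorem isNormal_tubeNrm {x s : ℝ} (hx : x ∈ Set.Ioo 0 (π / 2)) (hs : s ∈ Set.Ioo (0 : ℝ) 1) :
    IsNormal (ptA x) (tubeNrm x (s * vV x)) := by
  obtain ⟨h1, -⟩ := tube_angle hx hs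
  have := isNormal_faceA (suppA_swap_tubeNrm_lt h1).le
  rwa [faceA_tubeNrm ((dD_pos x).trans h1)] at this

theorem exists_tubeNrm_eq {n : E3} (hn : ‖n‖ = 1) (h0 : 0 < n 0) (h2 : 0 < n 2)
    (hlt : suppA (swap n) < suppA n) :
    ∃ x ∈ Set.Ioo 0 (π / 2), ∃ s ∈ Set.Ioo (0 : ℝ) 1, n = tubeNrm x (s * vV x) := by
  have hn2 := norm_sq_eq n
  rw [hn, one_pow] at hn2
  simp only [suppA, swap_zero, swap_one, neg_sq, neg_neg] at hlt
  have hw2 : √(n 0 ^ 2 + n 1 ^ 2) ^ 2 = n 0 ^ 2 + n 1 ^ 2 := sq_sqrt (by positivity)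
  have hw0 : 0 < √(n 0 ^ 2 + n 1 ^ 2) := sqrt_pos.2 (by positivity)
  have he2 : √(n 2 ^ 2 + n 1 ^ 2) ^ 2 = n 2 ^ 2 + n 1 ^ 2 := sq_sqrt (by positivity)
  have he0 : 0 ≤ √(n 2 ^ 2 + n 1 ^ 2) := sqrt_nonneg _
  set w := √(n 0 ^ 2 + n 1 ^ 2)
  set e := √(n 2 ^ 2 + n 1 ^ 2)
  have hw1 : w < 1 := by nlinarith
  have hn21 : n 2 ≤ 1 := by nlinarith
  obtain ⟨k, hk⟩ : ∃ k, n 1 = w * k := ⟨n 1 / w, by field_simp⟩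
  have hewk : e < w - w * k := by linarith
  have hk1 : 1 < 2 * w ^ 2 * (1 - k) := by nlinarith
  have hk2 : 0 < w ^ 2 * (1 - k ^ 2) := by nlinarith
  have hk3 : 0 < 1 - k ^ 2 := pos_of_mul_pos_right hk2 (by positivity)
  have hk4 : -1 < k := by nlinarith
  have hk5 : k < 1 / 2 := by nlinarith
  have hS2 : √((1 + k) / 2) ^ 2 = (1 + k) / 2 := sq_sqrt (by linarith)
  obtain ⟨x, hx, hxS⟩ := exists_sS_eq (a := √((1 + k) / 2)) (sqrt_pos.2 (by linarith)) (by linarith)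
  rw [← hxS] at hS2
  have hc2 : cC x ^ 2 = (1 - k) / 2 := by linarith [sS_sq x]
  have hS := sS_pos hx
  have hc := cC_pos x
  have hd := dD_pos x
  have hcd := cC_mul_dD x
  have hdw : dD x < w := by
    have h3 : (2 * (cC x * w)) ^ 2 = 2 * w ^ 2 * (1 - k) := by
      rw [mul_pow, mul_pow, hc2]
      ring
    have h4 : 1 < 2 * (cC x * w) := (one_lt_sq_iff₀ (by positivity)).1 (h3 ▸ hk1)
    have h5 : 0 < cC x * (w - dD x) := by linarith
    exact sub_pos.1 (pos_of_mul_pos_right h5 hc.le)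
  have hsin : sin (arcsin (n 2)) = n 2 := sin_arcsin (by linarith) hn21
  have hcos : cos (arcsin (n 2)) = w := by
    rw [cos_arcsin, ← sqrt_sq hw0.le]
    congr 1
    linarith
  have hφ : 0 < arcsin (n 2) := arcsin_pos.2 h2
  have hv := vV_pos hx
  have hφv : arcsin (n 2) < vV x := by
    by_contra! h
    have := cos_le_cos_of_nonneg_of_le_pi hv.le
      (by linarith [arcsin_le_pi_div_two (n 2), pi_pos]) h
    rw [hcos, cos_vV] at this
    linarith
  refine ⟨x, hx, arcsin (n 2) / vV x, ⟨by positivity, (div_lt_one hv).2 hφv⟩, ?_⟩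
  rw [div_mul_cancel₀ _ hv.ne']
  apply ext_three
  · have h3 : n 0 ^ 2 = (w * (2 * sS x * cC x)) ^ 2 := by
      simp only [mul_pow, hS2, hc2]
      linear_combination -hw2 - (n 1 + w * k) * hk
    simpa [tubeNrm, hcos] using (sq_eq_sq₀ h0.le (by positivity)).1 h3
  · simp [tubeNrm, hcos, hc2, hk]
    left
    ring
  · simp [tubeNrm, hsin]

theorem image_tubeMap : tubeMap '' (Set.Ioo 0 (π / 2) ×ˢ Set.Ioo 0 1 ×ˢ Set.Ioc 0 1) =
    layer (· > ·) := by
  ext z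
  constructor
  · rintro ⟨⟨x, s, ρ⟩, ⟨hx, hs, hρ0, hρ1⟩, rfl⟩
    simp only at hx hs hρ0 hρ1
    obtain ⟨h1, h2⟩ := tube_angle hx hs
    refine ⟨?_, _, ρ • tubeNrm x (s * vV x), (isNormal_tubeNrm hx hs).smul hρ0.le, ?_, ?_,
      tubeMap_eq x s ρ, ?_⟩
    · have h3 := sS_pos hx
      have h4 := cC_pos x
      have h5 := (dD_pos x).trans h1
      rw [tubeMap_eq]
      constructor <;> simp [ptA, tubeNrm] <;> positivity
    · refine smul_ne_zero hρ0.ne' fun h => ?_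
      simpa [h] using norm_tubeNrm x (s * vV x)
    · rw [norm_smul, norm_tubeNrm, norm_of_nonneg hρ0.le]
      linarith
    · rw [map_smul, suppA_smul hρ0.le, suppA_smul hρ0.le]
      exact mul_lt_mul_of_pos_left (suppA_swap_tubeNrm_lt h1) hρ0
  · rintro ⟨⟨hq0, hq2⟩, p, n, hp, hn0, hn1, rfl, hlt⟩
    obtain ⟨ρ, N, hρ, hρ1, hN, rfl⟩ := exists_smul_unit hn0 hn1
    replace hp := hp.of_smul hρ
    rw [map_smul, suppA_smul hρ.le, suppA_smul hρ.le, gt_iff_lt, mul_lt_mul_iff_right₀ hρ] at hlt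
    obtain ⟨rfl, -⟩ := hp.eq_faceA hlt
    simp [faceA] at hq0 hq2
    have h0 : 0 < N 0 := by
      by_contra! h
      have h3 := div_nonpos_of_nonpos_of_nonneg h (sqrt_nonneg (N 0 ^ 2 + N 1 ^ 2))
      nlinarith
    have h2 : 0 < N 2 := pos_of_mul_pos_right hq2 hρ.le
    obtain ⟨x, hx, s, hs, rfl⟩ := exists_tubeNrm_eq hN h0 h2 hlt
    exact ⟨(x, s, ρ), ⟨hx, hs, hρ, hρ1⟩, by
      rw [tubeMap_eq, faceA_tubeNrm ((dD_pos x).trans (tube_angle hx hs).1)]⟩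

theorem injOn_tubeMap : Set.InjOn tubeMap (Set.Ioo 0 (π / 2) ×ˢ Set.Ioo 0 1 ×ˢ Set.Ioc 0 1) := by
  rintro ⟨x, s, ρ⟩ ⟨hx, hs, hρ⟩ ⟨x', s', ρ'⟩ ⟨hx', hs', hρ'⟩ h
  simp only at hx hs hρ hx' hs' hρ'
  rw [tubeMap_eq, tubeMap_eq] at h
  have h1 := ((isNormal_tubeNrm hx hs).smul hρ.1.le).eq_of_add_eq
    ((isNormal_tubeNrm hx' hs').smul hρ'.1.le) h
  obtain rfl := ptA_injOn hx hx' h1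
  have h2 := add_left_cancel h
  have h3 : ‖ρ • tubeNrm x (s * vV x)‖ = ‖ρ' • tubeNrm x (s' * vV x)‖ := by rw [h2]
  rw [norm_smul, norm_smul, norm_tubeNrm, norm_tubeNrm, norm_of_nonneg hρ.1.le,
    norm_of_nonneg hρ'.1.le, mul_one, mul_one] at h3
  subst h3
  have h4 : tubeNrm x (s * vV x) = tubeNrm x (s' * vV x) := smul_right_injective _ hρ.1.ne' h2
  have h5 : tubeNrm x (s * vV x) 2 = tubeNrm x (s' * vV x) 2 := by rw [h4]
  have hv := vV_pos hx
  have hv' := vV_lt x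
  have h6 : s * vV x = s' * vV x := by
    refine injOn_sin ⟨?_, ?_⟩ ⟨?_, ?_⟩ (by simpa [tubeNrm] using h5)
    all_goals nlinarith [hs.1, hs.2, hs'.1, hs'.2, pi_pos]
  rw [mul_right_cancel₀ (ne_of_gt hv) h6]

/-! ### Volumes -/

theorem iteratedIntegral_nonneg {b : ℝ} (hb : 0 ≤ b) {J : ℝ → ℝ → ℝ → ℝ}
    (hpos : ∀ x ∈ Set.Icc 0 b, ∀ s ∈ Set.Icc (0 : ℝ) 1, ∀ ρ ∈ Set.Icc (0 : ℝ) 1, 0 ≤ J x s ρ) :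
    0 ≤ ∫ x in (0 : ℝ)..b, ∫ s in (0 : ℝ)..1, ∫ ρ in (0 : ℝ)..1, J x s ρ :=
  intervalIntegral.integral_nonneg hb fun x hx =>
    intervalIntegral.integral_nonneg zero_le_one fun s hs =>
      intervalIntegral.integral_nonneg zero_le_one fun ρ hρ => hpos x hx s hs ρ hρ

theorem volume_oloid_inter_quadrant :
    volume (oloid ∩ quadrant) =
      ENNReal.ofReal ((2 * ellipticE (√3 / 2) + ellipticK (√3 / 2)) / 6) ∧
    0 ≤ (2 * ellipticE (√3 / 2) + ellipticK (√3 / 2)) / 6 := by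
  have hc := continuous_cC
  have hd := continuous_dD
  have hs := continuous_sS
  have ht := continuous_tT
  have hpos : ∀ x ∈ Set.Icc 0 (π / 2), ∀ s ∈ Set.Icc (0 : ℝ) 1, ∀ ρ ∈ Set.Icc (0 : ℝ) 1,
      0 ≤ ρ ^ 2 * ((cC x + dD x) / 2)
        * ((1 - s) * (4 * tT x ^ 2) + s * (8 * sS x ^ 2 * dD x ^ 2)) := by
    intro x _ s hs ρ _
    have h1 := cC_pos x
    have h2 := dD_pos x
    have h3 := sub_nonneg.2 hs.2
    have h4 := hs.1
    positivity
  rw [← integral_cone, ← image_coneMap]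
  exact ⟨(volume_image_box hasFDerivAt_coneMap measurableSet_Ioo subset_rfl
    Set.Ioo_subset_Icc_self (by positivity) injOn_coneMap (by fun_prop) hpos
    fun q => by rw [det_coneJac]).2, iteratedIntegral_nonneg (by positivity) hpos⟩

theorem volume_layer_eq :
    MeasurableSet (layer (· = ·)) ∧
    volume (layer (· = ·)) = ENNReal.ofReal (π + 3 / 4 * ellipticK (√3 / 2)) := by
  have hd := continuous_dD
  have hs := continuous_sS
  have ht := continuous_tT
  rw [← integral_slab, ← image_slabMap]
  refine volume_image_box hasFDerivAt_slabMap measurableSet_Icc Set.Ioo_subset_Icc_self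
    subset_rfl (by positivity) injOn_slabMap (by fun_prop) ?_ fun q => by rw [det_slabJac]
  intro x _ s hs ρ hρ
  have h2 := dD_pos x
  have h3 := sub_nonneg.2 hs.2
  have h4 := hs.1
  have h5 := hρ.1
  positivity

theorem volume_layer_gt :
    MeasurableSet (layer (· > ·)) ∧
    volume (layer (· > ·)) = ENNReal.ofReal (3 * π ^ 2 / 16 - constI / 2 + π / 6) ∧
    0 ≤ 3 * π ^ 2 / 16 - constI / 2 + π / 6 := by
  have hv := continuous_vV
  have ht := continuous_tT
  have hpos : ∀ x ∈ Set.Icc 0 (π / 2), ∀ s ∈ Set.Icc (0 : ℝ) 1, ∀ ρ ∈ Set.Icc (0 : ℝ) 1,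
      0 ≤ 2 * tT x * vV x * (ρ * (1 + ρ * cos (s * vV x))) := by
    intro x hx s hs ρ hρ
    have h1 := tT_nonneg hx
    have h2 := vV_nonneg hx
    have h3 := hρ.1
    have h4 : 0 ≤ 1 + ρ * cos (s * vV x) := by nlinarith [neg_one_le_cos (s * vV x), hρ.2]
    positivity
  rw [← integral_tube, ← image_tubeMap]
  obtain ⟨h1, h2⟩ := volume_image_box hasFDerivAt_tubeMap measurableSet_Ioo subset_rfl
    Set.Ioo_subset_Icc_self (by positivity) injOn_tubeMap (by fun_prop) hpos
    fun q => by rw [det_tubeJac]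
  exact ⟨h1, h2, iteratedIntegral_nonneg (by positivity) hpos⟩

theorem volume_layer_lt :
    volume (layer (· < ·)) = ENNReal.ofReal (3 * π ^ 2 / 16 - constI / 2 + π / 6) := by
  have h : layer (· < ·) = swap ⁻¹' layer (· > ·) := by
    rw [← swap_image_layer (· < ·), Set.preimage_image_eq _ swap.injective]
  rw [h, swap.measurePreserving.measure_preimage volume_layer_gt.1.nullMeasurableSet,
    volume_layer_gt.2.1]

theorem ellipticK_nonneg : 0 ≤ ellipticK (√3 / 2) := by
  rw [ellipticK_eq]
  exact intervalIntegral.integral_nonneg (by positivity) fun x _ =>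
    mul_nonneg zero_le_two (dD_pos x).le

theorem isCompact_parallelBody : IsCompact parallelBody := by
  convert isCompact_oloid.add (isCompact_closedBall (0 : E3) 1)
  ext z
  rw [Set.mem_add]
  constructor
  · rintro ⟨p, hp, h⟩
    exact ⟨p, hp, z - p, by simpa using h, by abel⟩
  · rintro ⟨p, hp, n, hn, rfl⟩
    exact ⟨p, hp, by simpa using hn⟩

theorem map_mem_parallelBody {f : E3 ≃ₗᵢ[ℝ] E3} (hf : ∀ p ∈ oloid, f p ∈ oloid) {z : E3}
    (hz : z ∈ parallelBody) : f z ∈ parallelBody := by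
  obtain ⟨p, hp, h⟩ := hz
  exact ⟨f p, hf p hp, by rwa [← map_sub, f.norm_map]⟩

theorem measurableSet_coord_pos (i : Fin 3) : MeasurableSet {p : E3 | 0 < p i} :=
  measurableSet_lt (by fun_prop) (by fun_prop)

theorem measurableSet_quadrant : MeasurableSet quadrant :=
  (measurableSet_coord_pos 0).inter (measurableSet_coord_pos 2)

theorem volume_parallelBody_inter_quadrant :
    volume (parallelBody ∩ quadrant) = ENNReal.ofReal
      ((2 * ellipticE (√3 / 2) + ellipticK (√3 / 2)) / 6 + ((π + 3 / 4 * ellipticK (√3 / 2)) +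
        (3 * π ^ 2 / 16 - constI / 2 + π / 6 + (3 * π ^ 2 / 16 - constI / 2 + π / 6)))) := by
  obtain ⟨h1, h1'⟩ := volume_oloid_inter_quadrant
  obtain ⟨hm, h2⟩ := volume_layer_eq
  obtain ⟨hm', h3, h3'⟩ := volume_layer_gt
  have hK := ellipticK_nonneg
  have hm0 : MeasurableSet (oloid ∩ quadrant) :=
    isCompact_oloid.measurableSet.inter measurableSet_quadrant
  rw [parallelBody_inter_quadrant, measure_union' _ hm0, measure_union' _ hm, measure_union' _ hm',
    h1, h2, h3, volume_layer_lt, ENNReal.ofReal_add h1' (by positivity),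
    ENNReal.ofReal_add (q := _ + (_ + _)) (by positivity) (by positivity),
    ENNReal.ofReal_add h3' h3']
  · exact disjoint_layer fun a b h => h.asymm
  · exact Set.disjoint_union_right.2
      ⟨disjoint_layer fun a b h => h.not_gt, disjoint_layer fun a b h => h.not_lt⟩
  · exact Set.disjoint_union_right.2 ⟨disjoint_oloid_layer _,
      Set.disjoint_union_right.2 ⟨disjoint_oloid_layer _, disjoint_oloid_layer _⟩⟩

theorem volume_coord_eq_zero (i : Fin 3) : volume {p : E3 | p i = 0} = 0 := by
  let L : E3 →ₗ[ℝ] ℝ := (EuclideanSpace.proj i : E3 →L[ℝ] ℝ).toLinearMap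
  have h : {p : E3 | p i = 0} = (LinearMap.ker L : Set E3) := by
    ext p
    simp [L]
  rw [h]
  refine Measure.addHaar_submodule _ _ fun htop => ?_
  have h1 : EuclideanSpace.single i (1 : ℝ) ∈ LinearMap.ker L := htop ▸ Submodule.mem_top
  simp [L] at h1

theorem volume_eq_two_mul {C : Set E3} (hC : MeasurableSet C) {f : E3 ≃ₗᵢ[ℝ] E3}
    (hf : ∀ p, f (f p) = p) {i : Fin 3} (hi : ∀ p, f p i = -p i) (hfC : ∀ p ∈ C, f p ∈ C) :
    volume C = 2 * volume (C ∩ {p | 0 < p i}) := by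
  have hpos := measurableSet_coord_pos i
  have hneg : C ∩ {p | p i < 0} = f ⁻¹' (C ∩ {p | 0 < p i}) := by
    ext p
    simp only [Set.mem_inter_iff, Set.mem_preimage, Set.mem_ofPred_eq, hi, neg_pos]
    exact and_congr_left fun _ => ⟨hfC p, fun h => hf p ▸ hfC _ h⟩
  have hdiff : volume (C \ {p | 0 < p i}) = volume (C ∩ {p | p i < 0}) := by
    refine le_antisymm ?_ (measure_mono fun p hp => ⟨hp.1,
      fun h => lt_asymm h (Set.mem_ofPred_eq ▸ hp.2)⟩)
    refine (measure_mono (t := (C ∩ {p | p i < 0}) ∪ {p | p i = 0}) fun p hp => ?_).trans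
      ((measure_union_le _ _).trans_eq (by rw [volume_coord_eq_zero, add_zero]))
    have h : p i ≤ 0 := not_lt.1 hp.2
    exact h.lt_or_eq.imp (fun h => ⟨hp.1, h⟩) id
  rw [← measure_inter_add_sdiff C hpos, hdiff, hneg,
    f.measurePreserving.measure_preimage (hC.inter hpos).nullMeasurableSet, two_mul]

theorem volume_eq_four_mul {C : Set E3} (hC : MeasurableSet C) (h1 : ∀ p ∈ C, negFst p ∈ C)
    (h3 : ∀ p ∈ C, negThd p ∈ C) : volume C = 4 * volume (C ∩ quadrant) := by
  rw [volume_eq_two_mul hC negFst_negFst (i := 0) (by simp) h1,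
    volume_eq_two_mul (hC.inter (measurableSet_coord_pos 0)) negThd_negThd (i := 2) (by simp)
      fun p hp => ⟨h3 p hp.1, by simpa using hp.2⟩, ← mul_assoc, Set.inter_assoc]
  norm_num
  rfl

theorem volume_oloid :
    volume oloid = ENNReal.ofReal (2 / 3 * (2 * ellipticE (√3 / 2) + ellipticK (√3 / 2))) := by
  rw [volume_eq_four_mul isCompact_oloid.measurableSet (fun _ => negFst_mem_oloid)
    fun _ => negThd_mem_oloid, volume_oloid_inter_quadrant.1, ← ENNReal.ofReal_ofNat 4,
    ← ENNReal.ofReal_mul (by norm_num)]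
  congr 1
  ring

theorem volume_parallelBody :
    volume parallelBody = ENNReal.ofReal ((9 * π ^ 2 + 32 * π + 8 * ellipticE (√3 / 2)
      + 22 * ellipticK (√3 / 2) - 24 * constI) / 6) := by
  rw [volume_eq_four_mul isCompact_parallelBody.measurableSet
    (fun _ => map_mem_parallelBody fun _ => negFst_mem_oloid)
    fun _ => map_mem_parallelBody fun _ => negThd_mem_oloid, volume_parallelBody_inter_quadrant,
    ← ENNReal.ofReal_ofNat 4, ← ENNReal.ofReal_mul (by norm_num)]
  congr 1
  ring

theorem volume_parallelBody_pos : 0 < (9 * π ^ 2 + 32 * π + 8 * ellipticE (√3 / 2)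
      + 22 * ellipticK (√3 / 2) - 24 * constI) / 6 := by
  have h1 := volume_oloid_inter_quadrant.2
  have h2 := volume_layer_gt.2.2
  linarith [ellipticK_nonneg, pi_pos]

/-! ### Intersections with balls -/

theorem setOf_inter_closedBall_nonempty {r : ℝ} (hr : 0 < r) :
    {x | (oloidR r ∩ Metric.closedBall x r).Nonempty} = r • parallelBody := by
  ext x
  constructor
  · rintro ⟨_, ⟨p, hp, rfl⟩, h⟩
    refine ⟨r⁻¹ • x, ⟨p, hp, ?_⟩, by simp [smul_smul, hr.ne']⟩
    have h1 : r⁻¹ • x - p = r⁻¹ • (x - r • p) := by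
      rw [smul_sub, smul_smul, inv_mul_cancel₀ hr.ne', one_smul]
    have h2 : ‖x - r • p‖ ≤ r := by simpa [dist_eq_norm, norm_sub_rev] using h
    rw [h1, norm_smul, norm_inv, norm_of_nonneg hr.le, inv_mul_le_one₀ hr]
    exact h2
  · rintro ⟨z, ⟨p, hp, h⟩, rfl⟩
    refine ⟨r • p, ⟨p, hp, rfl⟩, ?_⟩
    rw [Metric.mem_closedBall', dist_eq_norm]
    change ‖r • z - r • p‖ ≤ r
    rw [← smul_sub, norm_smul, norm_of_nonneg hr.le]
    exact mul_le_of_le_one_right hr.le h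

theorem lintegral_volume_inter_closedBall (C : Set E3) (r : ℝ) :
    ∫⁻ x, volume (C ∩ Metric.closedBall x r) =
      volume C * volume (Metric.closedBall (0 : E3) r) := by
  have hm : MeasurableSet {q : E3 × E3 | dist q.2 q.1 ≤ r} :=
    (isClosed_le (by fun_prop) (by fun_prop)).measurableSet
  have h1 : ∀ x : E3, volume (C ∩ Metric.closedBall x r) =
      ∫⁻ y in C, {q : E3 × E3 | dist q.2 q.1 ≤ r}.indicator 1 (x, y) := by
    intro x
    rw [Set.inter_comm, ← Measure.restrict_apply measurableSet_closedBall,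
      ← lintegral_indicator_one measurableSet_closedBall]
    rfl
  have h2 : ∀ y : E3,
      ∫⁻ x, {q : E3 × E3 | dist q.2 q.1 ≤ r}.indicator (1 : E3 × E3 → ENNReal) (x, y) =
      volume (Metric.closedBall (0 : E3) r) := by
    intro y
    rw [← Measure.addHaar_closedBall_center volume y,
      ← lintegral_indicator_one measurableSet_closedBall]
    congr 1
    ext x
    simp only [Set.indicator, Set.mem_ofPred_eq, Metric.mem_closedBall, dist_comm]
    rfl
  simp only [h1]
  rw [lintegral_lintegral_swap (f := fun x y => {q : E3 × E3 | dist q.2 q.1 ≤ r}.indicator 1 (x, y))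
    (measurable_one.indicator hm).aemeasurable]
  simp only [h2, setLIntegral_const, mul_comm]

end Oloid

/-- The expected volume of the intersection of the fixed oloid `Ω_r` with a uniformly
placed hitting ball of radius `r`:
`(∫ vol(Ω_r ∩ B̄(x,r)) dλ(x)) / λ{x : Ω_r ∩ B̄(x,r) ≠ ∅}
  = 16π·[2E(√3/2) + K(√3/2)]·r³ / (3·[9π² + 32π + 8E(√3/2) + 22K(√3/2) − 24I])`. -/
theorem expected_volume_inter_ball (r : ℝ) (hr : 0 < r) :
    (∫⁻ x : EuclideanSpace ℝ (Fin 3), volume (oloidR r ∩ Metric.closedBall x r) ∂volume) /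
        volume {x : EuclideanSpace ℝ (Fin 3) | (oloidR r ∩ Metric.closedBall x r).Nonempty} =
      ENNReal.ofReal
        (16 * π * (2 * ellipticE (Real.sqrt 3 / 2) + ellipticK (Real.sqrt 3 / 2)) * r ^ 3 /
          (3 * (9 * π ^ 2 + 32 * π + 8 * ellipticE (Real.sqrt 3 / 2)
            + 22 * ellipticK (Real.sqrt 3 / 2) - 24 * constI))) := by
  have hD := Oloid.volume_parallelBody_pos
  have hV := Oloid.volume_oloid_inter_quadrant.2
  rw [Oloid.setOf_inter_closedBall_nonempty hr, Oloid.lintegral_volume_inter_closedBall, oloidR,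
    Measure.addHaar_smul, Measure.addHaar_smul, Oloid.volume_oloid, Oloid.volume_parallelBody,
    EuclideanSpace.volume_closedBall_fin_three, finrank_euclideanSpace_fin,
    abs_of_nonneg (by positivity), ← ENNReal.ofReal_pow hr.le]
  set V := 2 * ellipticE (√3 / 2) + ellipticK (√3 / 2)
  set D := 9 * π ^ 2 + 32 * π + 8 * ellipticE (√3 / 2) + 22 * ellipticK (√3 / 2) - 24 * constI
  have hD0 : 0 < D := by linarith
  have hV0 : 0 ≤ V := by linarith
  rw [← ENNReal.ofReal_mul (by positivity), ← ENNReal.ofReal_mul (by positivity),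
    ← ENNReal.ofReal_mul (by positivity), ← ENNReal.ofReal_mul (by positivity),
    ← ENNReal.ofReal_div_of_pos (by positivity)]
  congr 1
  field_simp
  ring
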